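/- VC dimension of generalized additive composite classes (Proposition 1, Section 5). Fix reals v_− < v_+, d∈ℕ*, r∈ℕ, t∈ℕ* and dyadic partitions π_1,...,π_d of [0,1] (π_j ∈ M^{B,1}, i.e. π_j is a dyadic partition of [0,1] into |π_j| = 2^{s_j} intervals for some s_j∈ℕ). Let Γ̄^A_{(π,t,r)} be the class of functions on [0,1]^d of the form γ(w) = f[(g(w) ∨ 0) ∧ 1], where g(w)=Σ_{j=1}^d g_j(w_j) with each g_j a piecewise polynomial of degree at most r on the partition π_j (real coefficients), and f = (f̃ ∨ v_−) ∧ v_+ with f̃ a piecewise polynomial of degree at most r on the regular partition of [0,1] into t intervals. Then Γ̄^A_{(π,t,r)} is a VC-subgraph class on [0,1]^d with dimension V^A_{(π,t,r)} ≤ 2 + [t(r+1) + 2·Σ_{j=1}^d |π_j|(r+1)]·log₂[4eU·log₂(2eU)], where U = t+r+2. -/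

import Mathlib

/-- The unit cube `[0,1]^d`. -/
def unitCube (d : ℕ) : Set (Fin d → ℝ) := {w | ∀ j, w j ∈ Set.Icc (0:ℝ) 1}

/-- A class `F` of real-valued functions on `W` is VC-subgraph on the domain `D ⊆ W` with
dimension not larger than `V`: no finite set of points of `D × ℝ` of cardinality exceeding
`V` is shattered by the open subgraphs `{(w,t) : t < f(w)}`, `f ∈ F`; i.e. for every such
set `S` there is a subset `S'` of `S` which is not of the form `S ∩ subgraph f`. -/
def VCSubgraphLEOn {W : Type*} (D : Set W) (F : Set (W → ℝ)) (V : ℝ) : Prop :=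
  ∀ S : Finset (W × ℝ), (∀ q ∈ S, q.1 ∈ D) → (S.card : ℝ) > V →
    ∃ S' ⊆ S, ∀ f ∈ F, (↑S' : Set (W × ℝ)) ≠ (↑S : Set (W × ℝ)) ∩ {q : W × ℝ | q.2 < f q.1}

/-- The cell of the dyadic partition of `[0,1]` into `2^s` intervals. -/
def dyadicCell (s k : ℕ) : Set ℝ :=
  if k = 0 then Set.Icc 0 ((2:ℝ) ^ (-(s:ℤ)))
  else Set.Ioc ((k:ℝ) * (2:ℝ) ^ (-(s:ℤ))) (((k:ℝ) + 1) * (2:ℝ) ^ (-(s:ℤ)))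

/-- The cell of the regular partition of `[0,1]` into `t` intervals. -/
def regularCell (t h : ℕ) : Set ℝ :=
  if h = 0 then Set.Icc 0 (1 / (t:ℝ))
  else Set.Ioc ((h:ℝ) / (t:ℝ)) (((h:ℝ) + 1) / (t:ℝ))

/-- Univariate piecewise polynomials of degree at most `r` on the dyadic partition of
`[0,1]` into `2^s` intervals (real coefficients). -/
def pwPolyDyadic1 (s r : ℕ) : Set (ℝ → ℝ) :=
  {g | ∀ k < 2 ^ s, ∃ c : Fin (r + 1) → ℝ,
      ∀ x ∈ dyadicCell s k, g x = ∑ i : Fin (r + 1), c i * x ^ (i : ℕ)}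

/-- Univariate piecewise polynomials of degree at most `r` on the regular partition of
`[0,1]` into `t` intervals (real coefficients). -/
def pwPolyRegular1 (t r : ℕ) : Set (ℝ → ℝ) :=
  {g | ∀ k < t, ∃ c : Fin (r + 1) → ℝ,
      ∀ x ∈ regularCell t k, g x = ∑ i : Fin (r + 1), c i * x ^ (i : ℕ)}

/-- The generalized additive composite class `Γ̄^A_{(π,t,r)}`: functions
`w ↦ f[(∑_j g_j(w_j) ∨ 0) ∧ 1]` where each `g_j` is a piecewise polynomial of degree at
most `r` on the dyadic partition `π_j` of `[0,1]` into `2^{s_j}` intervals, and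
`f = (f̃ ∨ v₋) ∧ v₊` with `f̃` a piecewise polynomial of degree at most `r` on the regular
partition of `[0,1]` into `t` intervals. -/
def additiveCompositeClass (d : ℕ) (s : Fin d → ℕ) (t r : ℕ) (vm vp : ℝ) :
    Set ((Fin d → ℝ) → ℝ) :=
  {γ | ∃ g : Fin d → ℝ → ℝ, (∀ j, g j ∈ pwPolyDyadic1 (s j) r) ∧
      ∃ ft ∈ pwPolyRegular1 t r,
        γ = fun w => min (max (ft (min (max (∑ j, g j (w j)) 0) 1)) vm) vp}

open MvPolynomial in
/-- A family of polynomials having more members than variables is algebraically dependent. -/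
lemma exists_ne_zero_eval_eq_zero_of_card_lt {V W : Type} [Fintype V] [Fintype W]
    (h : Fintype.card V < Fintype.card W) (F : W → MvPolynomial V ℝ) :
    ∃ G : MvPolynomial W ℝ, G ≠ 0 ∧ ∀ v : V → ℝ, eval (fun w => eval v (F w)) G = 0 := by
  have hdep : ¬ AlgebraicIndependent ℝ F := by
    intro hF
    have h1 := hF.cardinalMk_le_trdeg
    rw [MvPolynomial.trdeg_of_isDomain] at h1
    simp only [Cardinal.mk_fintype, Cardinal.lift_natCast, Nat.cast_le] at h1
    omega
  rw [algebraicIndependent_iff] at hdep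
  push Not at hdep
  obtain ⟨G, hG, hG0⟩ := hdep
  refine ⟨G, hG0, fun v => ?_⟩
  have := congrArg (eval v) hG
  rwa [map_zero, aeval_def, eval_eval₂, algebraMap_eq,
    show (eval v).comp C = RingHom.id ℝ by ext; simp] at this

open MvPolynomial in
/-- A nonzero polynomial does not vanish identically on a box with infinite sides. -/
lemma exists_eval_ne_zero_of_infinite {W : Type} {G : MvPolynomial W ℝ} (hG : G ≠ 0)
    (s : W → Set ℝ) (hs : ∀ w, (s w).Infinite) :
    ∃ v : W → ℝ, (∀ w, v w ∈ s w) ∧ eval v G ≠ 0 := by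
  by_contra! H
  exact hG (funext_set s hs fun x hx => by simpa using H x fun w => hx w trivial)

open MvPolynomial in
/-- Derivative of a polynomial function along a line. -/
lemma hasDerivAt_eval_line {τ : Type} [Fintype τ] (q : MvPolynomial τ ℝ) (y v : τ → ℝ) (s : ℝ) :
    HasDerivAt (fun s : ℝ => eval (y + s • v) q)
      (∑ j, eval (y + s • v) (pderiv j q) * v j) s := by
  classical
  induction q using MvPolynomial.induction_on with
  | C a => simpa using hasDerivAt_const s a
  | add p q hp hq =>
    simp only [map_add, add_mul, Finset.sum_add_distrib]
    exact hp.add hq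
  | mul_X p i hp =>
    have h1 : HasDerivAt (fun s : ℝ => y i + s * v i) (v i) s := by
      simpa using ((hasDerivAt_id s).mul_const (v i)).const_add (y i)
    have h2 := (hp.mul h1).congr_deriv (g' := ∑ j, eval (y + s • v) (pderiv j (p * X i)) * v j) <| by
      have h3 : ∑ j, eval (y + s • v) p * eval (y + s • v) (pderiv j (X i)) * v j =
          eval (y + s • v) p * v i := by
        rw [Finset.sum_eq_single i] <;> simp +contextual [pderiv_X, eq_comm]
      simp only [Derivation.leibniz, smul_eq_mul, map_add, map_mul, add_mul, eval_X,
        Finset.sum_add_distrib, h3, Finset.sum_mul]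
      rw [add_comm]
      congr 1
      refine Finset.sum_congr rfl fun j _ => ?_
      simp only [Pi.add_apply, Pi.smul_apply, smul_eq_mul]
      ring
    refine h2.congr_of_eventuallyEq (.of_forall fun s => ?_)
    simp

open MvPolynomial in
/-- After subtracting from each `p i` a generic affine function, the gradients of the polynomials
vanishing at a common point are linearly independent: a linear relation forces a polynomial
equation on the coefficients of the affine functions. -/
lemma exists_ne_zero_of_gradient_dependent {τ κ : Type} [Fintype τ] [Fintype κ]
    (p : Option κ → MvPolynomial τ ℝ) :
    ∃ G : MvPolynomial ((Option κ × τ) ⊕ Option κ) ℝ, G ≠ 0 ∧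
      ∀ (A : Option κ × τ → ℝ) (c : Option κ → ℝ) (x : τ → ℝ) (l : κ → ℝ),
        (∀ i, eval x (p i) - ∑ j, A (i, j) * x j = c i) →
        (∀ j, eval x (pderiv j (p none)) - A (none, j) =
          ∑ i, l i * (eval x (pderiv j (p (some i))) - A (some i, j))) →
        eval (Sum.elim A c) G = 0 := by
  let xv : τ → (κ × τ) ⊕ (τ ⊕ κ) := fun j => .inr (.inl j)
  let B : τ → MvPolynomial ((κ × τ) ⊕ (τ ⊕ κ)) ℝ := fun j =>
    rename xv (pderiv j (p none)) -
      ∑ i, X (.inr (.inr i)) * (rename xv (pderiv j (p (some i))) - X (.inl (i, j)))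
  let a : Option κ → τ → MvPolynomial ((κ × τ) ⊕ (τ ⊕ κ)) ℝ := fun i j =>
    i.elim (B j) fun i => X (.inl (i, j))
  let F : (Option κ × τ) ⊕ Option κ → MvPolynomial ((κ × τ) ⊕ (τ ⊕ κ)) ℝ :=
    Sum.elim (fun ij => a ij.1 ij.2) fun i => rename xv (p i) - ∑ j, a i j * X (xv j)
  obtain ⟨G, hG, hF⟩ := exists_ne_zero_eval_eq_zero_of_card_lt (by simp; ring_nf; omega) F
  refine ⟨G, hG, fun A c x l hc hl => ?_⟩
  rw [← hF (Sum.elim (fun ij => A (some ij.1, ij.2)) (Sum.elim x l))]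
  have hx : (Sum.elim (fun ij : κ × τ => A (some ij.1, ij.2)) (Sum.elim x l)) ∘ xv = x := by
    ext; simp [xv]
  have ha : ∀ i j, eval (Sum.elim (fun ij : κ × τ => A (some ij.1, ij.2)) (Sum.elim x l)) (a i j) =
      A (i, j) := by
    rintro (_ | i) j
    · have := hl j
      simp only [a, B, Option.elim, map_sub, eval_rename, hx, map_sum, map_mul, eval_X,
        Sum.elim_inr, Sum.elim_inl]
      linarith
    · simp [a]
  congr 2
  ext (⟨i, j⟩ | i)
  · simp [F, ha]
  · simp only [F, Sum.elim_inr, map_sub, eval_rename, hx, map_sum, map_mul, ha, eval_X, ← hc i]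
    simp [xv]

open MvPolynomial in
/-- For generic levels and generic base point, no Lagrange multiplier vanishes. -/
lemma exists_ne_zero_of_multiplier_zero {τ κ : Type} [Fintype τ] [Fintype κ]
    (q : Option κ → MvPolynomial τ ℝ) :
    ∃ G : MvPolynomial (Option κ ⊕ τ) ℝ, G ≠ 0 ∧
      ∀ (c : Option κ → ℝ) (a x : τ → ℝ) (l : κ → ℝ), (∀ i, eval x (q i) = c i) →
        (∀ j, x j - a j = ∑ i, l i * eval x (pderiv j (q (some i)))) →
        eval (Sum.elim c a) G = 0 := by
  let F : Option κ ⊕ τ → MvPolynomial (τ ⊕ κ) ℝ :=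
    Sum.elim (fun i => rename .inl (q i))
      fun j => X (.inl j) - ∑ i, X (.inr i) * rename .inl (pderiv j (q (some i)))
  obtain ⟨G, hG, hF⟩ := exists_ne_zero_eval_eq_zero_of_card_lt (by simp; omega) F
  refine ⟨G, hG, fun c a x l hc ha => ?_⟩
  rw [← hF (Sum.elim x l)]
  congr 2
  ext (i | j)
  · simp [F, eval_rename, hc]
  · simp only [F, Sum.elim_inr, map_sub, eval_X, Sum.elim_inl, map_sum, map_mul, eval_rename,
      Sum.elim_comp_inl, ← ha j]
    ring

/-- Number of monomials of degree at most `E`. -/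
lemma ncard_degree_le (τ : Type) [Fintype τ] (E : ℕ) :
    {m : τ →₀ ℕ | ∑ j, m j ≤ E}.ncard = (Fintype.card τ + E).choose (Fintype.card τ) := by
  classical
  have h : {m : τ →₀ ℕ | ∑ j, m j ≤ E} =
      ((Finset.range (E + 1)).biUnion fun e => (Finset.univ : Finset τ).finsuppAntidiag e) := by
    ext m
    simp
  rw [h, Set.ncard_coe_finset, Finset.card_biUnion]
  · simp only [Finset.card_finsuppAntidiag_nat_eq_multichoose, Finset.card_univ]
    rw [Nat.sum_range_multichoose, add_comm]
  · intro a _ b _ hab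
    rw [Function.onFun, Finset.disjoint_left]
    intro m hm hm'
    rw [Finset.mem_finsuppAntidiag] at hm hm'
    exact hab (hm.1.symm.trans hm'.1)

lemma finite_degree_le (τ : Type) [Fintype τ] (E : ℕ) : {m : τ →₀ ℕ | ∑ j, m j ≤ E}.Finite :=
  Set.finite_of_ncard_pos <| by
    rw [ncard_degree_le]
    exact Nat.choose_pos (by omega)

/-- Exponents of bidegree at most `(E, T)` in two groups of variables. -/
def bidegreeLE (τ κ : Type) [Fintype τ] [Fintype κ] (E T : ℕ) : Set (τ ⊕ κ →₀ ℕ) :=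
  {m | ∑ j, m (.inl j) ≤ E ∧ ∑ i, m (.inr i) ≤ T}

lemma bidegreeLE_eq_preimage (τ κ : Type) [Fintype τ] [Fintype κ] (E T : ℕ) :
    bidegreeLE τ κ E T = Finsupp.sumFinsuppEquivProdFinsupp ⁻¹'
      ({m : τ →₀ ℕ | ∑ j, m j ≤ E} ×ˢ {m : κ →₀ ℕ | ∑ i, m i ≤ T}) := by
  ext m
  simp [bidegreeLE]

lemma finite_bidegreeLE (τ κ : Type) [Fintype τ] [Fintype κ] (E T : ℕ) :
    (bidegreeLE τ κ E T).Finite := by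
  rw [bidegreeLE_eq_preimage]
  exact ((finite_degree_le τ E).prod (finite_degree_le κ T)).preimage
    (Equiv.injective _).injOn

lemma ncard_bidegreeLE (τ κ : Type) [Fintype τ] [Fintype κ] (E T : ℕ) :
    (bidegreeLE τ κ E T).ncard = (Fintype.card τ + E).choose (Fintype.card τ) *
      (Fintype.card κ + T).choose (Fintype.card κ) := by
  rw [bidegreeLE_eq_preimage, Set.ncard_preimage_of_injective_subset_range (Equiv.injective _)
    (by simp [(Equiv.surjective _).range_eq]), Set.ncard_prod, ncard_degree_le, ncard_degree_le]

lemma finrank_restrictSupport {σ : Type} {s : Set (σ →₀ ℕ)} :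
    Module.finrank ℝ (MvPolynomial.restrictSupport ℝ s) = s.ncard := by
  rw [Module.finrank_eq_nat_card_basis (MvPolynomial.basisRestrictSupport ℝ s), Set.ncard]
  rfl

lemma finite_restrictSupport {σ : Type} {s : Set (σ →₀ ℕ)} (hs : s.Finite) :
    Module.Finite ℝ (MvPolynomial.restrictSupport ℝ s) :=
  have := hs.to_subtype
  .of_basis (MvPolynomial.basisRestrictSupport ℝ s)

section Bidegree

open MvPolynomial

variable {τ κ : Type} [Fintype τ] [Fintype κ]

lemma mul_mem_bidegree {P Q : MvPolynomial (τ ⊕ κ) ℝ} {E₁ T₁ E₂ T₂ : ℕ}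
    (hP : P ∈ restrictSupport ℝ (bidegreeLE τ κ E₁ T₁))
    (hQ : Q ∈ restrictSupport ℝ (bidegreeLE τ κ E₂ T₂)) :
    P * Q ∈ restrictSupport ℝ (bidegreeLE τ κ (E₁ + E₂) (T₁ + T₂)) := by
  refine restrictSupport_mono ℝ ?_ (restrictSupport_add ℝ _ _ ▸ Submodule.mul_mem_mul hP hQ)
  rintro _ ⟨a, ⟨ha, ha'⟩, b, ⟨hb, hb'⟩, rfl⟩
  simp only [bidegreeLE, Set.mem_ofPred_eq, Finsupp.add_apply, Finset.sum_add_distrib]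
  omega

lemma restrictSupport_bidegree_mono {E T E' T' : ℕ} (hE : E ≤ E') (hT : T ≤ T') :
    restrictSupport ℝ (bidegreeLE τ κ E T) ≤ restrictSupport ℝ (bidegreeLE τ κ E' T') :=
  restrictSupport_mono ℝ fun _ h => ⟨h.1.trans hE, h.2.trans hT⟩

lemma one_mem_bidegree (E T : ℕ) :
    (1 : MvPolynomial (τ ⊕ κ) ℝ) ∈ restrictSupport ℝ (bidegreeLE τ κ E T) := by
  rw [show (1 : MvPolynomial (τ ⊕ κ) ℝ) = monomial 0 1 from rfl, monomial_mem_restrictSupport]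
  simp [bidegreeLE]

lemma pow_mem_bidegree {P : MvPolynomial (τ ⊕ κ) ℝ} {E T : ℕ}
    (hP : P ∈ restrictSupport ℝ (bidegreeLE τ κ E T)) (k : ℕ) :
    P ^ k ∈ restrictSupport ℝ (bidegreeLE τ κ (k * E) (k * T)) := by
  induction k with
  | zero => simpa using one_mem_bidegree 0 0
  | succ k ih => simpa [pow_succ, add_mul] using mul_mem_bidegree ih hP

lemma prod_pow_mem_bidegree {ι : Type} (s : Finset ι) {P : ι → MvPolynomial (τ ⊕ κ) ℝ} {E T : ℕ}
    (hP : ∀ i, P i ∈ restrictSupport ℝ (bidegreeLE τ κ E T)) (k : ι → ℕ) :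
    ∏ i ∈ s, P i ^ k i ∈
      restrictSupport ℝ (bidegreeLE τ κ ((∑ i ∈ s, k i) * E) ((∑ i ∈ s, k i) * T)) := by
  classical
  induction s using Finset.induction_on with
  | empty => simpa using one_mem_bidegree 0 0
  | insert a s ha ih =>
    rw [Finset.prod_insert ha, Finset.sum_insert ha, add_mul, add_mul]
    exact mul_mem_bidegree (pow_mem_bidegree (hP a) _) ih

lemma rename_inl_mem_bidegree {q : MvPolynomial τ ℝ} {D : ℕ} (hq : q.totalDegree ≤ D) :
    rename Sum.inl q ∈ restrictSupport ℝ (bidegreeLE τ κ D 0) := by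
  classical
  rw [mem_restrictSupport_iff]
  intro m hm
  rw [Finset.mem_coe, support_rename_of_injective Sum.inl_injective, Finset.mem_image] at hm
  obtain ⟨m, hm, rfl⟩ := hm
  constructor
  · have := (le_totalDegree hm).trans hq
    rw [Finsupp.sum_fintype _ _ (by simp)] at this
    simpa [Finsupp.mapDomain_apply Sum.inl_injective] using this
  · rw [Finset.sum_eq_zero]
    intro i _
    exact Finsupp.mapDomain_of_notMem_range _ _ (by simp)

lemma totalDegree_pderiv_le (q : MvPolynomial τ ℝ) (j : τ) :
    (pderiv j q).totalDegree ≤ q.totalDegree := by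
  classical
  conv_lhs => rw [q.as_sum, map_sum]
  refine totalDegree_finsetSum_le fun m hm => ?_
  rw [pderiv_monomial]
  refine (totalDegree_monomial_le _ _).trans (le_trans ?_ (le_totalDegree hm))
  rw [Finsupp.sum_fintype _ _ (by simp), Finsupp.sum_fintype _ _ (by simp)]
  exact Finset.sum_le_sum fun i _ => by simp

lemma X_inl_mem_bidegree (j : τ) :
    (X (.inl j) : MvPolynomial (τ ⊕ κ) ℝ) ∈ restrictSupport ℝ (bidegreeLE τ κ 1 0) := by
  classical
  rw [X, monomial_mem_restrictSupport]
  simp [bidegreeLE, Finsupp.single_apply]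

lemma X_inr_mem_bidegree (i : κ) :
    (X (.inr i) : MvPolynomial (τ ⊕ κ) ℝ) ∈ restrictSupport ℝ (bidegreeLE τ κ 0 1) := by
  classical
  rw [X, monomial_mem_restrictSupport]
  simp [bidegreeLE, Finsupp.single_apply]

end Bidegree

lemma exists_choose_lt_mul_choose (n : ℕ) {D : ℕ} (hD : 1 ≤ D) :
    ∃ T : ℕ, (n + (2 * D * T + (2 * D) ^ n)).choose n < ((2 * D) ^ n + 1) * (n + T).choose n := by
  set B := (2 * D) ^ n with hB
  have hlim : Filter.Tendsto (fun T : ℕ => (2 * D + (B : ℝ) * (1 / ((T : ℝ) + 1))) ^ n) Filter.atTop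
      (nhds ((2 * D + (B : ℝ) * 0) ^ n)) :=
    ((tendsto_one_div_add_atTop_nhds_zero_nat.const_mul _).const_add _).pow n
  have hlt : (2 * D + (B : ℝ) * 0) ^ n < (B : ℝ) + 1 := by
    rw [hB]; push_cast; simp
  obtain ⟨T, hT⟩ := (hlim.eventually (gt_mem_nhds hlt)).exists
  refine ⟨T, ?_⟩
  have key : ∀ E : ℕ, ((n + E).choose n : ℝ) * n.factorial = ∏ j ∈ Finset.range n,
      ((E : ℝ) + 1 + j) := by
    intro E
    have := Nat.ascFactorial_eq_factorial_mul_choose E n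
    rw [Nat.ascFactorial_eq_prod_range, add_comm E n] at this
    rw [mul_comm]
    exact_mod_cast this.symm
  have hT1 : (0 : ℝ) < (T : ℝ) + 1 := by positivity
  have hle : ((n + (2 * D * T + B)).choose n : ℝ) * n.factorial ≤
      (2 * D + (B : ℝ) * (1 / ((T : ℝ) + 1))) ^ n * (((n + T).choose n : ℝ) * n.factorial) := by
    rw [key, key]
    calc _ ≤ ∏ j ∈ Finset.range n, (2 * D + (B : ℝ) * (1 / ((T : ℝ) + 1))) * ((T : ℝ) + 1 + j) := by
          refine Finset.prod_le_prod (fun j _ => by positivity) fun j _ => ?_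
          have h1 : (B : ℝ) * (1 / ((T : ℝ) + 1)) * ((T : ℝ) + 1) = B := by field_simp
          have h2 : 0 ≤ (B : ℝ) * (1 / ((T : ℝ) + 1)) * j := by positivity
          have h3 : (1 : ℝ) ≤ D := by exact_mod_cast hD
          have h4 := mul_nonneg (sub_nonneg.2 h3) (by positivity : (0 : ℝ) ≤ 1 + j)
          push_cast
          nlinarith [(Nat.cast_nonneg j : (0 : ℝ) ≤ j)]
      _ = _ := by rw [Finset.prod_mul_distrib]; simp
  have hpos : (0 : ℝ) < ((n + T).choose n : ℝ) * n.factorial := by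
    have : 0 < (n + T).choose n := Nat.choose_pos (by omega)
    positivity
  have h := hle.trans_lt (mul_lt_mul_of_pos_right hT hpos)
  rw [← mul_assoc] at h
  have h' := lt_of_mul_lt_mul_right h (by positivity)
  exact_mod_cast h'

open MvPolynomial in
/-- Bezout-type bound: for generic `c`, `a`, a linear form takes at most `(2D)^n` values on the
critical points of `x ↦ |x - a|²` on `{q = c}`. -/
lemma exists_ne_zero_card_linear_values_le {τ κ : Type} [Fintype τ] [Fintype κ]
    (q : κ → MvPolynomial τ ℝ) {D : ℕ} (hD : 1 ≤ D) (hq : ∀ i, (q i).totalDegree ≤ D)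
    (u : τ → ℝ) :
    ∃ G : MvPolynomial (κ ⊕ τ) ℝ, G ≠ 0 ∧ ∀ (c : κ → ℝ) (a : τ → ℝ),
      eval (Sum.elim c a) G ≠ 0 → ∀ Y : Finset ℝ,
        (∀ t ∈ Y, ∃ (y : τ → ℝ) (l : κ → ℝ), t = ∑ j, u j * y j ∧ (∀ i, eval y (q i) = c i) ∧
          ∀ j, y j - a j = ∑ i, l i * eval y (pderiv j (q i))) →
        Y.card ≤ (2 * D) ^ Fintype.card τ := by
  obtain ⟨T, hT⟩ := exists_choose_lt_mul_choose (Fintype.card τ) hD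
  set B := (2 * D) ^ Fintype.card τ with hB
  let F : κ ⊕ τ → MvPolynomial (τ ⊕ κ) ℝ :=
    Sum.elim (fun i => rename .inl (q i))
      fun j => X (.inl j) - ∑ i, X (.inr i) * rename .inl (pderiv j (q i))
  let L : MvPolynomial (τ ⊕ κ) ℝ := ∑ j, C (u j) * X (.inl j)
  have hF₁ : ∀ i, F (.inl i) ∈ restrictSupport ℝ (bidegreeLE τ κ D 0) :=
    fun i => rename_inl_mem_bidegree (hq i)
  have hF₂ : ∀ j, F (.inr j) ∈ restrictSupport ℝ (bidegreeLE τ κ D 1) := by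
    intro j
    refine sub_mem (restrictSupport_bidegree_mono hD zero_le_one (X_inl_mem_bidegree j))
      (sum_mem fun i _ => ?_)
    simpa using mul_mem_bidegree (X_inr_mem_bidegree (τ := τ) i)
      (rename_inl_mem_bidegree ((totalDegree_pderiv_le (q i) j).trans (hq i)))
  have hL : L ∈ restrictSupport ℝ (bidegreeLE τ κ 1 0) := by
    refine sum_mem fun j _ => ?_
    rw [← smul_eq_C_mul]
    exact Submodule.smul_mem _ _ (X_inl_mem_bidegree j)
  have hmem : ∀ R ∈ restrictSupport ℝ (bidegreeLE κ τ T T), ∀ b : Fin (B + 1),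
      aeval F R * L ^ (b : ℕ) ∈ restrictSupport ℝ (bidegreeLE τ κ (2 * D * T + B) T) := by
    intro R hR b
    have h1 : aeval F R ∈ restrictSupport ℝ (bidegreeLE τ κ (2 * D * T) T) := by
      rw [aeval_def, eval₂_eq]
      refine sum_mem fun m hm => ?_
      rw [algebraMap_eq, ← smul_eq_C_mul]
      refine Submodule.smul_mem _ _ ?_
      obtain ⟨hm₁, hm₂⟩ := hR hm
      rw [Finset.prod_subset (Finset.subset_univ _) (by simp +contextual), Fintype.prod_sum_type]
      refine restrictSupport_bidegree_mono ?_ ?_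
        (mul_mem_bidegree (prod_pow_mem_bidegree _ hF₁ _) (prod_pow_mem_bidegree _ hF₂ _))
      · nlinarith
      · linarith
    refine restrictSupport_bidegree_mono ?_ ?_ (mul_mem_bidegree h1 (pow_mem_bidegree hL b))
    · have := b.2
      omega
    · simp
  let Ψ : (Fin (B + 1) → restrictSupport ℝ (bidegreeLE κ τ T T)) →ₗ[ℝ]
      restrictSupport ℝ (bidegreeLE τ κ (2 * D * T + B) T) :=
    ∑ b : Fin (B + 1), (((LinearMap.mulRight ℝ (L ^ (b : ℕ))) ∘ₗ (aeval F).toLinearMap ∘ₗ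
      (restrictSupport ℝ (bidegreeLE κ τ T T)).subtype).codRestrict _
        fun R => hmem R R.2 b) ∘ₗ LinearMap.proj b
  have := finite_restrictSupport (finite_bidegreeLE κ τ T T)
  have := finite_restrictSupport (finite_bidegreeLE τ κ (2 * D * T + B) T)
  have hker : LinearMap.ker Ψ ≠ ⊥ := by
    refine LinearMap.ker_ne_bot_of_finrank_lt ?_
    rw [Module.finrank_pi_fintype]
    simp only [finrank_restrictSupport, ncard_bidegreeLE, Finset.sum_const, Finset.card_univ,
      Fintype.card_fin, smul_eq_mul]
    have hpos : 0 < (Fintype.card κ + T).choose (Fintype.card κ) := Nat.choose_pos (by omega)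
    nlinarith
  obtain ⟨R, hR, hR0⟩ := (Submodule.ne_bot_iff _).1 hker
  obtain ⟨b₀, hb₀⟩ := Function.ne_iff.1 hR0
  have hrel : ∑ b : Fin (B + 1), aeval F (R b : MvPolynomial (κ ⊕ τ) ℝ) * L ^ (b : ℕ) = 0 := by
    have := congrArg Subtype.val (LinearMap.mem_ker.1 hR)
    simpa [Ψ] using this
  refine ⟨R b₀, by simpa using hb₀, fun c a hG Y hY => ?_⟩
  let P : Polynomial ℝ := ∑ b : Fin (B + 1),
    Polynomial.C (eval (Sum.elim c a) (R b : MvPolynomial (κ ⊕ τ) ℝ)) * Polynomial.X ^ (b : ℕ)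
  have hP : P ≠ 0 := by
    intro h
    have := congrArg (fun p => Polynomial.coeff p (b₀ : ℕ)) h
    simp only [P, Polynomial.finsetSum_coeff, Polynomial.coeff_C_mul, Polynomial.coeff_X_pow,
      Polynomial.coeff_zero, mul_ite, mul_one, mul_zero, ← Fin.ext_iff] at this
    simp at this
    exact hG this
  have hdeg : P.natDegree ≤ B :=
    Polynomial.natDegree_sum_le_of_forall_le _ _ fun b _ =>
      (Polynomial.natDegree_C_mul_X_pow_le _ _).trans (by omega)
  refine le_trans (Polynomial.card_le_degree_of_subset_roots (p := P) ?_) hdeg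
  intro t ht
  obtain ⟨y, l, rfl, hc, ha⟩ := hY t ht
  rw [Polynomial.mem_roots hP, Polynomial.IsRoot]
  have h := congrArg (eval (Sum.elim y l)) hrel
  have hv : (fun w => eval (Sum.elim y l) (F w)) = Sum.elim c a := by
    ext (i | j)
    · simp [F, eval_rename, hc]
    · simp only [F, Sum.elim_inr, map_sub, eval_X, Sum.elim_inl, map_sum, map_mul, eval_rename,
        Sum.elim_comp_inl, ← ha j]
      ring
  have hev : ∀ G : MvPolynomial (κ ⊕ τ) ℝ,
      eval (Sum.elim y l) (aeval F G) = eval (Sum.elim c a) G := by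
    intro G
    rw [aeval_def, eval_eval₂, algebraMap_eq,
      show (eval (Sum.elim y l)).comp C = RingHom.id ℝ by ext; simp, hv]
    rfl
  simp only [map_sum, map_mul, map_pow, map_zero, hev] at h
  simpa [P, Polynomial.eval_finsetSum, L] using h

/-- Finitely many linear forms suffice to separate the points of every set of at most `N`
points. -/
lemma exists_finset_linear_injOn (τ : Type) [Fintype τ] (N : ℕ) :
    ∃ W : Finset (τ → ℝ), ∀ Y : Finset (τ → ℝ), Y.card ≤ N →
      ∃ u ∈ W, Set.InjOn (fun y : τ → ℝ => ∑ j, u j * y j) Y := by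
  classical
  let e := Fintype.equivFin τ
  let n := Fintype.card τ
  refine ⟨(Finset.range (N * N * n + 1)).image fun (t : ℕ) j => (t : ℝ) ^ (e j : ℕ), fun Y hY => ?_⟩
  let P : (τ → ℝ) → Polynomial ℝ := fun v => ∑ j, Polynomial.C (v j) * Polynomial.X ^ (e j : ℕ)
  have hP : ∀ v, v ≠ 0 → P v ≠ 0 := by
    intro v hv h
    obtain ⟨j, hj⟩ := Function.ne_iff.1 hv
    have := congrArg (fun p => Polynomial.coeff p (e j : ℕ)) h
    simp only [P, Polynomial.finsetSum_coeff, Polynomial.coeff_C_mul, Polynomial.coeff_X_pow,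
      Polynomial.coeff_zero, mul_ite, mul_one, mul_zero, ← Fin.ext_iff, e.injective.eq_iff] at this
    simp at this
    exact hj this
  have hdeg : ∀ v, (P v).natDegree ≤ n := fun v =>
    Polynomial.natDegree_sum_le_of_forall_le _ _ fun j _ =>
      (Polynomial.natDegree_C_mul_X_pow_le _ _).trans (e j).2.le
  let Q : Polynomial ℝ := ∏ z ∈ Y.offDiag, P (z.1 - z.2)
  have hQ : Q ≠ 0 := Finset.prod_ne_zero_iff.2 fun z hz =>
    hP _ (sub_ne_zero.2 (Finset.mem_offDiag.1 hz).2.2)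
  have hQdeg : Q.natDegree ≤ N * N * n := by
    refine (Polynomial.natDegree_prod_le _ _).trans ((Finset.sum_le_card_nsmul _ _ n
      fun z _ => hdeg _).trans ?_)
    rw [smul_eq_mul]
    refine Nat.mul_le_mul_right _ ?_
    rw [Finset.offDiag_card]
    exact (Nat.sub_le _ _).trans (Nat.mul_le_mul hY hY)
  obtain ⟨t, ht, hQt⟩ : ∃ t ∈ Finset.range (N * N * n + 1), Q.eval (t : ℝ) ≠ 0 := by
    by_contra! H
    have := Polynomial.card_le_degree_of_subset_roots (p := Q)
      (Z := (Finset.range (N * N * n + 1)).image (fun t : ℕ => (t : ℝ))) (by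
        intro x hx
        obtain ⟨t, ht, rfl⟩ := Finset.mem_image.1 (Finset.mem_val ▸ hx)
        exact (Polynomial.mem_roots hQ).2 (H t ht))
    rw [Finset.card_image_of_injective _ Nat.cast_injective, Finset.card_range] at this
    omega
  refine ⟨_, Finset.mem_image_of_mem _ ht, fun y hy z hz hyz => ?_⟩
  by_contra hne
  simp only [Q, Polynomial.eval_prod] at hQt
  refine Finset.prod_ne_zero_iff.1 hQt (y, z) (Finset.mem_offDiag.2 ⟨hy, hz, hne⟩) ?_
  simp only [P, Polynomial.eval_finsetSum, Polynomial.eval_mul, Polynomial.eval_C,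
    Polynomial.eval_pow, Polynomial.eval_X, Pi.sub_apply, sub_mul, Finset.sum_sub_distrib]
  simp only [mul_comm] at hyz ⊢
  rw [hyz, sub_self]

open MvPolynomial in
/-- Bezout-type bound: for generic `c`, `a`, there are at most `(2D)^n` critical points of
`x ↦ |x - a|²` on `{q = c}`. -/
lemma exists_ne_zero_card_critical_le {τ κ : Type} [Fintype τ] [Fintype κ]
    (q : κ → MvPolynomial τ ℝ) {D : ℕ} (hD : 1 ≤ D) (hq : ∀ i, (q i).totalDegree ≤ D) :
    ∃ G : MvPolynomial (κ ⊕ τ) ℝ, G ≠ 0 ∧ ∀ (c : κ → ℝ) (a : τ → ℝ),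
      eval (Sum.elim c a) G ≠ 0 → ∀ Y : Finset (τ → ℝ),
        (∀ y ∈ Y, ∃ l : κ → ℝ, (∀ i, eval y (q i) = c i) ∧
          ∀ j, y j - a j = ∑ i, l i * eval y (pderiv j (q i))) →
        Y.card ≤ (2 * D) ^ Fintype.card τ := by
  classical
  obtain ⟨W, hW⟩ := exists_finset_linear_injOn τ ((2 * D) ^ Fintype.card τ + 1)
  choose G hG hbound using exists_ne_zero_card_linear_values_le q hD hq
  refine ⟨∏ u ∈ W, G u, Finset.prod_ne_zero_iff.2 fun u _ => hG u, fun c a hca Y hY => ?_⟩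
  by_contra! hlt
  obtain ⟨Z, hZY, hZ⟩ := Finset.exists_subset_card_eq (Nat.succ_le_of_lt hlt)
  obtain ⟨u, hu, hinj⟩ := hW Z hZ.le
  rw [map_prod, Finset.prod_ne_zero_iff] at hca
  have := hbound u c a (hca u hu) (Z.image fun y => ∑ j, u j * y j) (by
    intro t ht
    obtain ⟨y, hy, rfl⟩ := Finset.mem_image.1 ht
    obtain ⟨l, hl⟩ := hY y (hZY hy)
    exact ⟨y, l, rfl, hl⟩)
  rw [Finset.card_image_of_injOn hinj, hZ] at this
  omega

/-- Farkas' lemma for linearly independent constraints. -/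
lemma exists_nonneg_multiplier_of_linearIndependent {τ κ : Type} [Fintype τ] [Fintype κ]
    {g : κ → τ → ℝ} (hg : LinearIndependent ℝ g) {w : τ → ℝ}
    (hw : ∀ v : τ → ℝ, (∀ i, 0 < ∑ j, g i j * v j) → 0 ≤ ∑ j, w j * v j) :
    ∃ l : κ → ℝ, (∀ i, 0 ≤ l i) ∧ ∀ j, w j = ∑ i, l i * g i j := by
  classical
  let M : Matrix κ τ ℝ := Matrix.of g
  have hsurj : ∀ b : κ → ℝ, ∃ v : τ → ℝ, ∀ i, ∑ j, g i j * v j = b i := by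
    have h : LinearIndependent ℝ M.row := hg
    have hs : Function.Surjective M.mulVecLin := by
      rw [← LinearMap.range_eq_top]
      refine Submodule.eq_top_of_finrank_eq ?_
      rw [Module.finrank_fintype_fun_eq_card]
      exact h.rank_matrix
    intro b
    obtain ⟨v, hv⟩ := hs b
    exact ⟨v, fun i => congrFun hv i⟩
  obtain ⟨v₁, hv₁⟩ := hsurj 1
  have hzero : ∀ v : τ → ℝ, (∀ i, 0 ≤ ∑ j, g i j * v j) → 0 ≤ ∑ j, w j * v j := by
    intro v hv
    have h : ∀ ε : ℝ, 0 < ε → 0 ≤ ∑ j, w j * v j + ε * ∑ j, w j * v₁ j := by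
      intro ε hε
      have := hw (v + ε • v₁) fun i => by
        have h1 : ∑ j, g i j * (v + ε • v₁) j = ∑ j, g i j * v j + ε * ∑ j, g i j * v₁ j := by
          simp only [Pi.add_apply, Pi.smul_apply, smul_eq_mul, mul_add, Finset.sum_add_distrib,
            Finset.mul_sum, mul_left_comm]
        rw [h1, hv₁]
        have := hv i
        simp only [Pi.one_apply]
        positivity
      refine this.trans_eq ?_
      simp only [Pi.add_apply, Pi.smul_apply, smul_eq_mul, mul_add, Finset.sum_add_distrib,
        Finset.mul_sum, mul_left_comm]
    by_contra! hneg
    set b := ∑ j, w j * v₁ j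
    set a := ∑ j, w j * v j
    have h1 := h (-a / (2 * (|b| + 1))) (by have := abs_nonneg b; apply div_pos <;> linarith)
    have h2 : -a / (2 * (|b| + 1)) * b ≤ -a / 2 := by
      have h3 : -a / (2 * (|b| + 1)) * b ≤ -a / (2 * (|b| + 1)) * (|b| + 1) :=
        mul_le_mul_of_nonneg_left (by linarith [le_abs_self b])
          (by have := abs_nonneg b; apply div_nonneg <;> linarith)
      refine h3.trans_eq ?_
      have := abs_nonneg b
      field_simp
    linarith
  have hker : ∀ v : τ → ℝ, (∀ i, ∑ j, g i j * v j = 0) → ∑ j, w j * v j = 0 := by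
    intro v hv
    refine le_antisymm ?_ (hzero v fun i => (hv i).ge)
    have := hzero (-v) fun i => by simp [hv]
    simpa using this
  choose e he using fun i : κ => hsurj (Pi.single i 1)
  refine ⟨fun i => ∑ j, w j * e i j, fun i => hzero _ fun k => ?_, fun j => ?_⟩
  · rw [he]
    by_cases h : k = i
    · subst h; simp
    · simp [h]
  · have := hker (Pi.single j 1 - ∑ i, g i j • e i) fun k => by
      have h1 : ∑ x, g k x * ∑ i, g i j * e i x = ∑ i, g i j * ∑ x, g k x * e i x := by
        simp only [Finset.mul_sum]
        rw [Finset.sum_comm]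
        simp only [mul_left_comm]
      simp only [Pi.sub_apply, mul_sub, Finset.sum_sub_distrib, Finset.sum_apply, Pi.smul_apply,
        smul_eq_mul, h1, he]
      simp [Pi.single_apply]
    have h1 : ∑ x, w x * ∑ i, g i j * e i x = ∑ i, (∑ x, w x * e i x) * g i j := by
      simp only [Finset.mul_sum, Finset.sum_mul]
      rw [Finset.sum_comm]
      refine Finset.sum_congr rfl fun i _ => Finset.sum_congr rfl fun x _ => by ring
    simp only [Pi.sub_apply, mul_sub, Finset.sum_sub_distrib, Finset.sum_apply, Pi.smul_apply,
      smul_eq_mul, h1] at this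
    simp [Pi.single_apply] at this
    linarith

lemma injective_option_elim_erase {ι : Type*} [DecidableEq ι] (I : Finset ι) (i : ι) :
    Function.Injective fun o : Option (I.erase i) => o.elim i (↑) := by
  rintro (_ | j) (_ | k) h
  · rfl
  · exact absurd h.symm (Finset.ne_of_mem_erase k.2)
  · exact absurd h (Finset.ne_of_mem_erase j.2)
  · exact congrArg some (Subtype.ext h)

open MvPolynomial in
/-- After subtracting a generic affine function from each `p i`, the gradients of the polynomials
vanishing at a common point are linearly independent. -/
lemma exists_ne_zero_linearIndepOn_gradient {τ ι : Type} [Fintype τ] [Fintype ι]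
    (p : ι → MvPolynomial τ ℝ) :
    ∃ G : MvPolynomial ((ι × τ) ⊕ ι) ℝ, G ≠ 0 ∧ ∀ (A : ι × τ → ℝ) (c : ι → ℝ),
      eval (Sum.elim A c) G ≠ 0 → ∀ (x : τ → ℝ) (I : Finset ι),
        (∀ i ∈ I, eval x (p i) - ∑ j, A (i, j) * x j = c i) →
        LinearIndependent ℝ fun (i : I) j => eval x (pderiv j (p i)) - A (i, j) := by
  classical
  let φ : ∀ k : Finset ι × ι, Option (k.1.erase k.2) → ι := fun k o => o.elim k.2 (↑)
  have hφ : ∀ k, Function.Injective (φ k) := fun k => injective_option_elim_erase k.1 k.2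
  choose G hG hdep using fun k => exists_ne_zero_of_gradient_dependent fun o => p (φ k o)
  refine ⟨∏ k, rename (Sum.map (Prod.map (φ k) id) (φ k)) (G k),
    Finset.prod_ne_zero_iff.2 fun k _ => ?_, fun A c hAc x I hI => ?_⟩
  · rw [Ne, rename_eq_zero_iff_of_injective]
    · exact hG k
    · exact Sum.map_injective.2 ⟨Function.Injective.prodMap (hφ k) Function.injective_id, hφ k⟩
  rw [Fintype.linearIndependent_iff]
  by_contra! H
  obtain ⟨g, hg, i₀, hi₀⟩ := H
  rw [map_prod, Finset.prod_ne_zero_iff] at hAc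
  refine hAc (I, ↑i₀) (Finset.mem_univ _) ?_
  rw [eval_rename, Sum.elim_comp_map]
  refine hdep (I, ↑i₀) _ _ x
    (fun i => -(g ⟨i, Finset.mem_of_mem_erase i.2⟩ / g i₀)) ?_ fun j => ?_
  · rintro (_ | i)
    · exact hI _ i₀.2
    · exact hI _ (Finset.mem_of_mem_erase i.2)
  · have h := congrFun hg j
    simp only [Finset.sum_apply, Pi.smul_apply, smul_eq_mul, Pi.zero_apply] at h
    rw [← Finset.add_sum_erase _ _ (Finset.mem_univ i₀)] at h
    have hs : ∑ i ∈ Finset.univ.erase i₀, g i * (eval x (pderiv j (p i)) - A (i, j)) =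
        ∑ i : I.erase ↑i₀, g ⟨i, Finset.mem_of_mem_erase i.2⟩ *
          (eval x (pderiv j (p i)) - A (i, j)) := by
      refine Finset.sum_bij' (fun i hi => ⟨i, Finset.mem_erase.2
          ⟨fun h => Finset.ne_of_mem_erase hi (Subtype.ext h), i.2⟩⟩)
        (fun i _ => ⟨i, Finset.mem_of_mem_erase i.2⟩) ?_ ?_ ?_ ?_ ?_
      · simp
      · intro i _
        simpa [Subtype.ext_iff] using Finset.ne_of_mem_erase i.2
      · simp
      · simp
      · simp
    rw [hs] at h
    simp only [φ, Option.elim, Function.comp, Prod.map, id]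
    rw [eq_neg_of_add_eq_zero_left h |> fun h' => (eq_div_of_mul_eq hi₀ ((mul_comm _ _).trans h')),
      neg_div, Finset.sum_div, ← Finset.sum_neg_distrib]
    exact Finset.sum_congr rfl fun i _ => by ring

open MvPolynomial in
/-- For generic `c` and `a`, every Lagrange multiplier of a critical point of `x ↦ |x - a|²` on
`{x | ∀ i ∈ I, q i = c i}` is nonzero. -/
lemma exists_ne_zero_multiplier_ne_zero {τ ι : Type} [Fintype τ] [Fintype ι]
    (q : ι → MvPolynomial τ ℝ) :
    ∃ G : MvPolynomial (ι ⊕ τ) ℝ, G ≠ 0 ∧ ∀ (c : ι → ℝ) (a : τ → ℝ),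
      eval (Sum.elim c a) G ≠ 0 → ∀ (x : τ → ℝ) (I : Finset ι) (l : ι → ℝ),
        (∀ i ∈ I, eval x (q i) = c i) →
        (∀ j, x j - a j = ∑ i ∈ I, l i * eval x (pderiv j (q i))) → ∀ i ∈ I, l i ≠ 0 := by
  classical
  let φ : ∀ k : Finset ι × ι, Option (k.1.erase k.2) → ι := fun k o => o.elim k.2 (↑)
  have hφ : ∀ k, Function.Injective (φ k) := fun k => injective_option_elim_erase k.1 k.2
  choose G hG hdep using fun k => exists_ne_zero_of_multiplier_zero fun o => q (φ k o)
  refine ⟨∏ k, rename (Sum.map (φ k) id) (G k),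
    Finset.prod_ne_zero_iff.2 fun k _ => ?_, fun c a hca x I l hI ha i₀ hi₀ hl => ?_⟩
  · rw [Ne, rename_eq_zero_iff_of_injective]
    · exact hG k
    · exact Sum.map_injective.2 ⟨hφ k, Function.injective_id⟩
  rw [map_prod, Finset.prod_ne_zero_iff] at hca
  refine hca (I, i₀) (Finset.mem_univ _) ?_
  rw [eval_rename, Sum.elim_comp_map]
  refine hdep (I, i₀) _ _ x (fun i => l i) ?_ fun j => ?_
  · rintro (_ | i)
    · exact hI _ hi₀
    · exact hI _ (Finset.mem_of_mem_erase i.2)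
  · rw [Function.comp_id, ha j, ← Finset.add_sum_erase _ _ hi₀, hl, zero_mul, zero_add]
    exact (Finset.sum_coe_sort (I.erase i₀) fun i => l i * eval x (pderiv j (q i))).symm

open MvPolynomial in
/-- For generic `c` and `a`, and every `I`, there are at most `(2D)^n` critical points of
`x ↦ |x - a|²` on `{x | ∀ i ∈ I, q i = c i}`. -/
lemma exists_ne_zero_forall_card_critical_le {τ ι : Type} [Fintype τ] [Fintype ι]
    (q : ι → MvPolynomial τ ℝ) {D : ℕ} (hD : 1 ≤ D) (hq : ∀ i, (q i).totalDegree ≤ D) :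
    ∃ G : MvPolynomial (ι ⊕ τ) ℝ, G ≠ 0 ∧ ∀ (c : ι → ℝ) (a : τ → ℝ),
      eval (Sum.elim c a) G ≠ 0 → ∀ (I : Finset ι) (Y : Finset (τ → ℝ)),
        (∀ y ∈ Y, ∃ l : ι → ℝ, (∀ i ∈ I, eval y (q i) = c i) ∧
          ∀ j, y j - a j = ∑ i ∈ I, l i * eval y (pderiv j (q i))) →
        Y.card ≤ (2 * D) ^ Fintype.card τ := by
  classical
  choose G hG hbound using fun I : Finset ι =>
    exists_ne_zero_card_critical_le (fun i : I => q i) hD fun i => hq i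
  refine ⟨∏ I, rename (Sum.map (↑) id) (G I),
    Finset.prod_ne_zero_iff.2 fun I _ => ?_, fun c a hca I Y hY => ?_⟩
  · rw [Ne, rename_eq_zero_iff_of_injective]
    · exact hG I
    · exact Sum.map_injective.2 ⟨Subtype.val_injective, Function.injective_id⟩
  rw [map_prod, Finset.prod_ne_zero_iff] at hca
  have h := hca I (Finset.mem_univ _)
  rw [eval_rename, Sum.elim_comp_map] at h
  refine hbound I _ _ h Y fun y hy => ?_
  obtain ⟨l, hc, ha⟩ := hY y hy
  refine ⟨fun i => l i, fun i => hc i i.2, fun j => ?_⟩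
  rw [Function.comp_id, ha j]
  exact (Finset.sum_coe_sort I fun i => l i * eval y (pderiv j (q i))).symm

open Filter Topology in
lemma HasDerivAt.eventually_lt_of_pos {f : ℝ → ℝ} {f' : ℝ} (hf : HasDerivAt f f' 0) (h : 0 < f') :
    ∀ᶠ s in 𝓝[>] 0, f 0 < f s := by
  have h1 := (hasDerivAt_iff_tendsto_slope.1 hf).mono_left
    (nhdsWithin_mono 0 fun s (hs : 0 < s) => hs.ne')
  filter_upwards [h1.eventually (lt_mem_nhds h), self_mem_nhdsWithin] with s hs hs0
  rw [slope_def_field, sub_zero] at hs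
  have := (div_pos_iff_of_pos_right hs0).1 hs
  linarith

/-- The squared distance to a point attains its minimum on a nonempty closed set. -/
lemma exists_minimizer_sum_sq {τ : Type} [Fintype τ] {K : Set (τ → ℝ)} (hK : IsClosed K)
    (hne : K.Nonempty) (a : τ → ℝ) :
    ∃ y ∈ K, ∀ z ∈ K, ∑ j, (y j - a j) ^ 2 ≤ ∑ j, (z j - a j) ^ 2 := by
  obtain ⟨x, hx⟩ := hne
  set f : (τ → ℝ) → ℝ := fun z => ∑ j, (z j - a j) ^ 2 with hf
  have hcont : Continuous f := by fun_prop
  have hcomp : IsCompact (K ∩ {z | f z ≤ f x}) := by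
    refine (isCompact_closedBall a (f x + 1)).of_isClosed_subset
      (hK.inter (isClosed_le hcont continuous_const)) fun z hz => ?_
    have h0 : 0 ≤ f x := Finset.sum_nonneg fun j _ => sq_nonneg _
    rw [Metric.mem_closedBall, dist_pi_le_iff (by linarith)]
    intro j
    have h1 : (z j - a j) ^ 2 ≤ f x :=
      (Finset.single_le_sum (f := fun j => (z j - a j) ^ 2) (fun j _ => sq_nonneg _)
        (Finset.mem_univ j)).trans hz.2
    rw [Real.dist_eq]
    exact abs_le_of_sq_le_sq (by nlinarith) (by linarith)
  obtain ⟨y, hy, hmin⟩ := hcomp.exists_isMinOn ⟨x, hx, le_refl (f x)⟩ hcont.continuousOn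
  refine ⟨y, hy.1, fun z hz => ?_⟩
  by_cases h : f z ≤ f x
  · exact hmin ⟨hz, h⟩
  · exact hy.2.trans (not_le.1 h).le

open MvPolynomial Filter Topology in
/-- Karush-Kuhn-Tucker conditions for the point of `{z | ∀ i, 0 ≤ σ i * (q i z - c i)}` nearest
to `a`. -/
lemma exists_kkt_point {τ ι : Type} [Fintype τ] [Fintype ι] (q : ι → MvPolynomial τ ℝ)
    (c σ : ι → ℝ) (a : τ → ℝ) (hσ : ∀ i, σ i = 1 ∨ σ i = -1)
    (hind : ∀ (x : τ → ℝ) (I : Finset ι), (∀ i ∈ I, eval x (q i) = c i) →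
      LinearIndependent ℝ fun (i : I) j => eval x (pderiv j (q i)))
    {x : τ → ℝ} (hx : ∀ i, 0 ≤ σ i * (eval x (q i) - c i)) :
    ∃ (y : τ → ℝ) (I : Finset ι) (l : ι → ℝ), (∀ i ∈ I, eval y (q i) = c i) ∧
      (∀ i ∉ I, 0 < σ i * (eval y (q i) - c i)) ∧ (∀ i ∈ I, 0 ≤ σ i * l i) ∧
      ∀ j, y j - a j = ∑ i ∈ I, l i * eval y (pderiv j (q i)) := by
  classical
  obtain ⟨y, hy, hmin⟩ := exists_minimizer_sum_sq
    (K := {z | ∀ i, 0 ≤ σ i * (eval z (q i) - c i)})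
    (by
      simp only [Set.ofPred_forall]
      exact isClosed_iInter fun i => isClosed_le continuous_const
        (continuous_const.mul ((MvPolynomial.continuous_eval _).sub continuous_const))) ⟨x, hx⟩ a
  have hσ0 : ∀ i, σ i ≠ 0 := fun i => by rcases hσ i with h | h <;> simp [h]
  have hσσ : ∀ i, σ i * σ i = 1 := fun i => by rcases hσ i with h | h <;> simp [h]
  let I : Finset ι := {i | eval y (q i) = c i}
  have hI : ∀ i ∈ I, eval y (q i) = c i := fun i hi => (Finset.mem_filter.1 hi).2
  have hIc : ∀ i ∉ I, 0 < σ i * (eval y (q i) - c i) := fun i hi =>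
    lt_of_le_of_ne (hy i) (mul_ne_zero (hσ0 i) (sub_ne_zero.2 (by simpa [I] using hi))).symm
  have hg : LinearIndependent ℝ fun (i : I) j => σ i * eval y (pderiv j (q i)) :=
    (hind y I hI).units_smul fun i : I => Units.mk0 (σ i) (hσ0 i)
  obtain ⟨l, hl, hyl⟩ := exists_nonneg_multiplier_of_linearIndependent hg (w := fun j => y j - a j)
    (by
      intro v hv
      by_contra! hneg
      have hline : ∀ s : ℝ, ∀ i, HasDerivAt (fun s : ℝ => σ i * (eval (y + s • v) (q i) - c i))
          (σ i * ∑ j, eval (y + s • v) (pderiv j (q i)) * v j) s := fun s i =>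
        ((hasDerivAt_eval_line (q i) y v s).sub_const _).const_mul _
      have hfeas : ∀ i, ∀ᶠ s in 𝓝[>] (0 : ℝ), 0 ≤ σ i * (eval (y + s • v) (q i) - c i) := by
        intro i
        by_cases hi : i ∈ I
        · have h0 := hv ⟨i, hi⟩
          simp only [mul_assoc, ← Finset.mul_sum] at h0
          filter_upwards [(hline 0 i).eventually_lt_of_pos (by simpa using h0)] with s hs
          simp only [zero_smul, add_zero, hI i hi, sub_self, mul_zero] at hs
          exact hs.le
        · have := (hline 0 i).continuousAt.eventually (lt_mem_nhds (a := 0) (by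
            simpa using hIc i hi))
          filter_upwards [this.filter_mono nhdsWithin_le_nhds] with s hs using hs.le
      have hdist : ∀ᶠ s in 𝓝[>] (0 : ℝ),
          ∑ j, ((y + s • v) j - a j) ^ 2 < ∑ j, (y j - a j) ^ 2 := by
        have hd : HasDerivAt (fun s : ℝ => -∑ j, ((y + s • v) j - a j) ^ 2)
            (-∑ j, 2 * ((y j - a j) * v j)) 0 := by
          refine (HasDerivAt.fun_sum fun j _ => ?_).neg
          have h1 : HasDerivAt (fun s : ℝ => y j + s * v j - a j) (v j) 0 := by
            simpa using (((hasDerivAt_id (0 : ℝ)).mul_const (v j)).const_add (y j)).sub_const (a j)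
          refine (h1.pow 2).congr_deriv ?_
          simp
          ring
        filter_upwards [hd.eventually_lt_of_pos (by rw [← Finset.mul_sum]; linarith)] with s hs
        simp only [zero_smul, add_zero] at hs
        linarith
      obtain ⟨s, hs₁, hs₂⟩ := ((eventually_all.2 hfeas).and hdist).exists
      exact (hmin _ hs₁).not_gt hs₂)
  refine ⟨y, I, fun i => if hi : i ∈ I then l ⟨i, hi⟩ * σ i else 0, hI, hIc, fun i hi => ?_,
    fun j => ?_⟩
  · beta_reduce
    rw [dif_pos hi, mul_left_comm, hσσ, mul_one]
    exact hl _
  · rw [hyl j, ← Finset.sum_coe_sort I]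
    exact Finset.sum_congr rfl fun i _ => by simp [mul_assoc]

open MvPolynomial in
/-- Under generic conditions, the number of sign patterns is bounded by the number of pairs formed
by a set of at most `n` active constraints and one of its `N` critical points. -/
lemma card_sign_patterns_le_of_generic {τ ι : Type} [Fintype τ] [Fintype ι]
    (q : ι → MvPolynomial τ ℝ) (c : ι → ℝ) (a : τ → ℝ) (N : ℕ)
    (hind : ∀ (x : τ → ℝ) (I : Finset ι), (∀ i ∈ I, eval x (q i) = c i) →
      LinearIndependent ℝ fun (i : I) j => eval x (pderiv j (q i)))
    (hmul : ∀ (x : τ → ℝ) (I : Finset ι) (l : ι → ℝ), (∀ i ∈ I, eval x (q i) = c i) →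
      (∀ j, x j - a j = ∑ i ∈ I, l i * eval x (pderiv j (q i))) → ∀ i ∈ I, l i ≠ 0)
    (hcard : ∀ (I : Finset ι) (Y : Finset (τ → ℝ)),
      (∀ y ∈ Y, ∃ l : ι → ℝ, (∀ i ∈ I, eval y (q i) = c i) ∧
        ∀ j, y j - a j = ∑ i ∈ I, l i * eval y (pderiv j (q i))) → Y.card ≤ N)
    (T : Finset (Set ι))
    (hT : ∀ P ∈ T, ∃ x, ∀ i, (i ∈ P → c i < eval x (q i)) ∧ (i ∉ P → eval x (q i) < c i)) :
    T.card ≤ N * ∑ k ∈ Finset.range (Fintype.card τ + 1), (Fintype.card ι).choose k := by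
  classical
  let σ : Set ι → ι → ℝ := fun P i => if i ∈ P then 1 else -1
  have hσ : ∀ P i, σ P i = 1 ∨ σ P i = -1 := fun P i => by
    by_cases h : i ∈ P <;> simp [σ, h]
  have key : ∀ P, ∃ (y : τ → ℝ) (I : Finset ι) (l : ι → ℝ), P ∈ T →
      (∀ i ∈ I, eval y (q i) = c i) ∧
      (∀ i ∉ I, 0 < σ P i * (eval y (q i) - c i)) ∧ (∀ i ∈ I, 0 ≤ σ P i * l i) ∧
      ∀ j, y j - a j = ∑ i ∈ I, l i * eval y (pderiv j (q i)) := by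
    intro P
    by_cases hP : P ∈ T
    · obtain ⟨x, hx⟩ := hT P hP
      obtain ⟨y, I, l, h⟩ := exists_kkt_point q c (σ P) a (hσ P) hind (x := x) fun i => by
        by_cases hi : i ∈ P
        · simpa [σ, hi] using ((hx i).1 hi).le
        · simpa [σ, hi] using ((hx i).2 hi).le
      exact ⟨y, I, l, fun _ => h⟩
    · exact ⟨0, ∅, 0, fun h => absurd h hP⟩
  choose y I l h using key
  have hIcard : ∀ P ∈ T, (I P).card ≤ Fintype.card τ := by
    intro P hP
    have := (hind _ _ (h P hP).1).fintype_card_le_finrank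
    simpa using this
  have hinj : ∀ P ∈ T, ∀ Q ∈ T, I P = I Q → y P = y Q → P = Q := by
    intro P hP Q hQ hI hy
    have hl : ∀ i ∈ I P, l P i = l Q i := by
      intro i hi
      have h0 := Fintype.linearIndependent_iff.1 (hind _ _ (h P hP).1)
        (fun i => l P i - l Q i) (by
          ext j
          have h1 := (h P hP).2.2.2 j
          have h2 := (h Q hQ).2.2.2 j
          rw [← hI, ← hy, h1] at h2
          rw [← Finset.sum_coe_sort, ← Finset.sum_coe_sort (I P)] at h2
          simp only [Finset.sum_apply, Pi.smul_apply, smul_eq_mul, sub_mul,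
            Finset.sum_sub_distrib, Pi.zero_apply]
          exact sub_eq_zero.2 h2) ⟨i, hi⟩
      exact sub_eq_zero.1 h0
    have hsgn : ∀ (b : ℝ) i, 0 < σ P i * b → 0 < σ Q i * b → (i ∈ P ↔ i ∈ Q) := by
      intro b i hb hb'
      by_cases h1 : i ∈ P <;> by_cases h2 : i ∈ Q <;> simp [σ, h1, h2] at hb hb' ⊢ <;> linarith
    ext i
    by_cases hi : i ∈ I P
    · have hne := hmul _ _ _ (h P hP).1 (h P hP).2.2.2 i hi
      have hσne : ∀ R, σ R i ≠ 0 := fun R => by rcases hσ R i with h | h <;> simp [h]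
      refine hsgn (l P i) i (((h P hP).2.2.1 i hi).lt_of_ne (mul_ne_zero (hσne P) hne).symm) ?_
      exact (hl i hi ▸ (h Q hQ).2.2.1 i (hI ▸ hi)).lt_of_ne (mul_ne_zero (hσne Q) hne).symm
    · exact hsgn _ i ((h P hP).2.1 i hi) (hy ▸ (h Q hQ).2.1 i (hI ▸ hi))
  have hmaps : ∀ P ∈ T, I P ∈ (Finset.range (Fintype.card τ + 1)).biUnion
      fun k => (Finset.univ : Finset ι).powersetCard k := fun P hP => by
    simpa [Nat.lt_succ_iff] using hIcard P hP
  refine (Finset.card_le_mul_card_image_of_maps_to hmaps N fun J _ => ?_).trans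
    (Nat.mul_le_mul_left _ (Finset.card_biUnion_le.trans (by simp)))
  rw [← Finset.card_image_of_injOn (f := y)]
  · refine hcard J _ fun z hz => ?_
    obtain ⟨P, hPJ, rfl⟩ := Finset.mem_image.1 hz
    obtain ⟨hP, rfl⟩ := Finset.mem_filter.1 hPJ
    exact ⟨l P, (h P hP).1, (h P hP).2.2.2⟩
  · intro P hP Q hQ hPQ
    obtain ⟨hP, hPJ⟩ := Finset.mem_filter.1 hP
    obtain ⟨hQ, hQJ⟩ := Finset.mem_filter.1 hQ
    exact hinj P hP Q hQ (hPJ.trans hQJ.symm) hPQ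

open MvPolynomial Filter Topology in
/-- The number of sign patterns `{i | 0 < p i x}` of polynomials of degree at most `D` in `n`
variables. -/
lemma card_sign_patterns_le {τ ι : Type} [Fintype τ] [Fintype ι]
    (p : ι → MvPolynomial τ ℝ) {D : ℕ} (hD : 1 ≤ D) (hp : ∀ i, (p i).totalDegree ≤ D)
    (T : Finset (Set ι)) (hT : ∀ P ∈ T, ∃ x, P = {i | 0 < eval x (p i)}) :
    T.card ≤ (2 * D) ^ Fintype.card τ *
      ∑ k ∈ Finset.range (Fintype.card τ + 1), (Fintype.card ι).choose k := by
  classical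
  choose! x hx using hT
  obtain ⟨δ, hδ, hδ0⟩ : ∃ δ : ℝ, (∀ P ∈ T, ∀ i, 0 < eval (x P) (p i) →
      4 * δ < eval (x P) (p i)) ∧ 0 < δ := by
    have : ∀ᶠ δ in 𝓝[>] (0 : ℝ), ∀ P ∈ T, ∀ i, 0 < eval (x P) (p i) →
        4 * δ < eval (x P) (p i) := by
      refine (Finset.eventually_all T).2 fun P _ => eventually_all.2 fun i => ?_
      by_cases h : 0 < eval (x P) (p i)
      · have h1 : Tendsto (fun δ : ℝ => 4 * δ) (𝓝[>] 0) (𝓝 (4 * 0)) :=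
          (tendsto_id.const_mul 4).mono_left nhdsWithin_le_nhds
        rw [mul_zero] at h1
        filter_upwards [h1.eventually (gt_mem_nhds h)] with δ hδ _ using hδ
      · exact .of_forall fun _ h' => absurd h' h
    exact (this.and self_mem_nhdsWithin).exists
  obtain ⟨η, hη, hη0⟩ : ∃ η : ℝ, (∀ P ∈ T, η * ∑ j, |x P j| < δ) ∧ 0 < η := by
    have : ∀ᶠ η in 𝓝[>] (0 : ℝ), ∀ P ∈ T, η * ∑ j, |x P j| < δ := by
      refine (Finset.eventually_all T).2 fun P _ => ?_
      have h1 : Tendsto (fun η : ℝ => η * ∑ j, |x P j|) (𝓝[>] 0) (𝓝 (0 * ∑ j, |x P j|)) :=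
        (tendsto_id.mul_const _).mono_left nhdsWithin_le_nhds
      rw [zero_mul] at h1
      exact h1.eventually (gt_mem_nhds hδ0)
    exact (this.and self_mem_nhdsWithin).exists
  obtain ⟨G₁, hG₁, hind⟩ := exists_ne_zero_linearIndepOn_gradient p
  obtain ⟨v, hv, hv0⟩ := exists_eval_ne_zero_of_infinite hG₁ (fun _ => Set.Ioo 0 η)
    fun _ => Set.Ioo_infinite hη0
  let A : ι × τ → ℝ := fun z => v (.inl z)
  let q : ι → MvPolynomial τ ℝ := fun i => p i - ∑ j, C (A (i, j)) * X j
  have hq : ∀ i, (q i).totalDegree ≤ D := fun i => by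
    refine (totalDegree_sub _ _).trans (max_le (hp i) ((totalDegree_finsetSum _ _).trans
      (Finset.sup_le fun j _ => (totalDegree_mul _ _).trans ?_)))
    simpa using hD
  have hqe : ∀ z i, eval z (q i) = eval z (p i) - ∑ j, A (i, j) * z j := fun z i => by simp [q]
  have hqd : ∀ z i j, eval z (pderiv j (q i)) = eval z (pderiv j (p i)) - A (i, j) := by
    intro z i j
    simp [q, pderiv_X, Pi.single_apply, Derivation.leibniz]
  let G₁' : MvPolynomial ι ℝ := aeval (Sum.elim (fun z => C (A z)) X) G₁
  have hG₁' : ∀ c : ι → ℝ, eval c G₁' = eval (Sum.elim A c) G₁ := by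
    intro c
    simp only [G₁', aeval_def, eval_eval₂, algebraMap_eq]
    rw [show (eval c).comp C = RingHom.id ℝ by ext; simp]
    change eval _ _ = _
    congr 2
    ext (z | i) <;> simp
  have hG₁'0 : G₁' ≠ 0 := by
    intro h0
    have h1 := hG₁' fun i => v (.inr i)
    rw [h0, map_zero] at h1
    refine hv0 (Eq.trans ?_ h1.symm)
    congr 2
    ext (z | i) <;> simp [A]
  obtain ⟨G₂, hG₂, hmul⟩ := exists_ne_zero_multiplier_ne_zero q
  obtain ⟨G₃, hG₃, hcard⟩ := exists_ne_zero_forall_card_critical_le q hD hq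
  have hG₁'' : rename (Sum.inl : ι → ι ⊕ τ) G₁' ≠ 0 := by
    rwa [Ne, rename_eq_zero_iff_of_injective _ Sum.inl_injective]
  obtain ⟨w, hw, hw0⟩ := exists_eval_ne_zero_of_infinite
    (mul_ne_zero (mul_ne_zero hG₁'' hG₂) hG₃) (fun _ => Set.Ioo δ (2 * δ))
    fun _ => Set.Ioo_infinite (by linarith)
  have hw' : w = Sum.elim (fun i => w (.inl i)) fun j => w (.inr j) := by ext (_ | _) <;> rfl
  generalize hc : (fun i => w (.inl i)) = c at hw'
  generalize (fun j => w (.inr j)) = a at hw'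
  rw [hw', map_mul, map_mul, eval_rename, Sum.elim_comp_inl, mul_ne_zero_iff, mul_ne_zero_iff,
    hG₁'] at hw0
  have hcδ : ∀ i, δ < c i ∧ c i < 2 * δ := fun i => hc ▸ hw (.inl i)
  refine card_sign_patterns_le_of_generic q c a _ (fun z I hz => ?_) (hmul c a hw0.1.2)
    (hcard c a hw0.2) T fun P hP => ⟨x P, fun i => ?_⟩
  · simp only [hqd]
    exact hind A c hw0.1.1 z I fun i hi => by rw [← hqe, hz i hi]
  · have hbound : |∑ j, A (i, j) * x P j| < δ := by
      refine lt_of_le_of_lt ((Finset.abs_sum_le_sum_abs _ _).trans ?_) (hη P hP)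
      rw [Finset.mul_sum]
      refine Finset.sum_le_sum fun j _ => ?_
      rw [abs_mul, abs_of_pos (hv (.inl (i, j))).1]
      exact mul_le_mul_of_nonneg_right (hv (.inl (i, j))).2.le (abs_nonneg _)
    rw [abs_lt] at hbound
    rw [hqe]
    have hmem : i ∈ P ↔ 0 < eval (x P) (p i) := by
      conv_lhs => rw [hx P hP]
      rfl
    refine ⟨fun hi => ?_, fun hi => ?_⟩
    · have := hδ P hP i (hmem.1 hi)
      linarith [(hcδ i).2]
    · have := not_lt.1 (mt hmem.2 hi)
      linarith [(hcδ i).1]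

/-- Partial sums of binomial coefficients are at most `(em/n)^n`. -/
lemma sum_choose_le_exp_mul_div_pow {m n : ℕ} (hn : 0 < n) (hnm : n ≤ m) :
    (∑ k ∈ Finset.range (n + 1), (m.choose k : ℝ)) ≤ (Real.exp 1 * m / n) ^ n := by
  have hn0 : (0 : ℝ) < n := by exact_mod_cast hn
  have hm0 : (0 : ℝ) < m := by exact_mod_cast hn.trans_le hnm
  set u : ℝ := n / m with hu
  have hu0 : 0 < u := by positivity
  have hu1 : u ≤ 1 := by
    rw [hu, div_le_one hm0]
    exact_mod_cast hnm
  have h1 : u ^ n * ∑ k ∈ Finset.range (n + 1), (m.choose k : ℝ) ≤ Real.exp 1 ^ n := by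
    calc _ = ∑ k ∈ Finset.range (n + 1), u ^ n * (m.choose k : ℝ) := Finset.mul_sum _ _ _
      _ ≤ ∑ k ∈ Finset.range (n + 1), u ^ k * (m.choose k : ℝ) := by
          refine Finset.sum_le_sum fun k hk => mul_le_mul_of_nonneg_right
            (pow_le_pow_of_le_one hu0.le hu1 ?_) (Nat.cast_nonneg _)
          exact Nat.lt_succ_iff.1 (Finset.mem_range.1 hk)
      _ ≤ ∑ k ∈ Finset.range (m + 1), u ^ k * (m.choose k : ℝ) :=
          Finset.sum_le_sum_of_subset_of_nonneg (by simpa using hnm)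
            fun k _ _ => by positivity
      _ = (u + 1) ^ m := by simp [add_pow]
      _ ≤ Real.exp u ^ m := by gcongr; exact Real.add_one_le_exp u
      _ = Real.exp 1 ^ n := by
          rw [← Real.exp_nat_mul, ← Real.exp_nat_mul, hu]
          congr 1
          field_simp
  have h2 : (Real.exp 1 * m / n) ^ n = Real.exp 1 ^ n / u ^ n := by
    rw [← div_pow, hu]
    congr 1
    field_simp
  rw [h2, le_div_iff₀ (by positivity), mul_comm]
  exact h1

open MvPolynomial in
/-- Warren's theorem: `m` polynomials of degree at most `D` in `n ≤ m` variables have at most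
`(2emD/n)^n` sign patterns. -/
lemma card_sign_patterns_le_exp_pow {τ ι : Type} [Fintype τ] [Fintype ι]
    (p : ι → MvPolynomial τ ℝ) {D : ℕ} (hD : 1 ≤ D) (hp : ∀ i, (p i).totalDegree ≤ D)
    (hτ : 0 < Fintype.card τ) (hι : Fintype.card τ ≤ Fintype.card ι)
    (T : Finset (Set ι)) (hT : ∀ P ∈ T, ∃ x, P = {i | 0 < eval x (p i)}) :
    (T.card : ℝ) ≤ (2 * Real.exp 1 * Fintype.card ι * D / Fintype.card τ) ^ Fintype.card τ := by
  have h1 : (T.card : ℝ) ≤ ((2 * D) ^ Fintype.card τ *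
      ∑ k ∈ Finset.range (Fintype.card τ + 1), (Fintype.card ι).choose k : ℕ) := by
    exact_mod_cast card_sign_patterns_le p hD hp T hT
  refine h1.trans ?_
  push_cast
  refine (mul_le_mul_of_nonneg_left (sum_choose_le_exp_mul_div_pow hτ hι)
    (by positivity)).trans_eq ?_
  rw [← mul_pow]
  congr 1
  ring

lemma two_le_logb_two_mul_logb {b : ℝ} (hb : 4 ≤ b) :
    2 ≤ Real.logb 2 b ∧ 2 ≤ Real.logb 2 (2 * b * Real.logb 2 b) := by
  have h1 : (2 : ℝ) ≤ Real.logb 2 b := by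
    rw [Real.le_logb_iff_rpow_le (by norm_num) (by linarith)]
    norm_num
    exact hb
  refine ⟨h1, ?_⟩
  rw [Real.le_logb_iff_rpow_le (by norm_num) (by nlinarith)]
  norm_num
  nlinarith

/-- Explicit solution of `b x < 2 ^ x`, in logarithmic form. -/
lemma log_mul_lt_mul_log_two {b x : ℝ} (hb : 4 ≤ b)
    (hx : Real.logb 2 (2 * b * Real.logb 2 b) < x) :
    Real.log (b * x) < x * Real.log 2 := by
  obtain ⟨hL, hx₀⟩ := two_le_logb_two_mul_logb hb
  set L := Real.logb 2 b with hLdef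
  set x₀ := Real.logb 2 (2 * b * L)
  have hln : 0.69 < Real.log 2 := by linarith [Real.log_two_gt_d9]
  have hb' : Real.log b = L * Real.log 2 := by
    rw [hLdef, Real.logb, div_mul_cancel₀]
    linarith
  have hx₀' : x₀ * Real.log 2 = Real.log 2 + Real.log b + Real.log L := by
    rw [← Real.log_mul (by norm_num) (by linarith), ← Real.log_mul (by linarith) (by linarith)]
    simp only [x₀, Real.logb]
    rw [div_mul_cancel₀]
    linarith
  have hlogL : Real.log L ≤ (L - 1) * Real.log 2 := by
    have h := Real.log_le_sub_one_of_pos (x := L / 2) (by linarith)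
    rw [Real.log_div (by linarith) (by norm_num)] at h
    nlinarith
  have hx₀L : x₀ ≤ 2 * L := by
    have : x₀ * Real.log 2 ≤ 2 * L * Real.log 2 := by linarith
    exact le_of_mul_le_mul_right this (by linarith)
  have hlogx₀ : Real.log x₀ ≤ Real.log 2 + Real.log L := by
    rw [← Real.log_mul (by norm_num) (by linarith)]
    exact Real.log_le_log (by linarith) hx₀L
  have hlogx : Real.log x ≤ Real.log x₀ + (x - x₀) / 2 := by
    have h := Real.log_le_sub_one_of_pos (x := x / x₀) (by apply div_pos <;> linarith)
    rw [Real.log_div (by linarith) (by linarith)] at h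
    have h2 : x / x₀ - 1 = (x - x₀) / x₀ := by
      have : x₀ ≠ 0 := by linarith
      field_simp
    have h3 : (x - x₀) / x₀ ≤ (x - x₀) / 2 :=
      div_le_div_of_nonneg_left (by linarith) (by norm_num) hx₀
    linarith
  rw [Real.log_mul (by linarith) (by linarith)]
  nlinarith

/-- Weighted arithmetic-geometric mean inequality, in logarithmic form. -/
lemma mul_log_add_mul_log_le {P n u v x : ℝ} (hP : 0 < P) (hn : 0 < n) (hu : 0 < u) (hv : 0 < v)
    (hx : 0 < x) :
    P * Real.log (x * u / P) + n * Real.log (x * v / n) ≤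
      (P + n) * Real.log (x * (u + v) / (P + n)) := by
  have key : ∀ {a w : ℝ}, 0 < a → 0 < w → a * Real.log (x * w / a) ≤
      a * Real.log (x * (u + v) / (P + n)) + (w * (P + n) / (u + v) - a) := by
    intro a w ha hw
    have h1 : x * w / a = x * (u + v) / (P + n) * (w * (P + n) / (u + v) / a) := by field_simp
    have h2 := Real.log_le_sub_one_of_pos (x := w * (P + n) / (u + v) / a) (by positivity)
    rw [h1, Real.log_mul (by positivity) (by positivity), mul_add]
    gcongr
    refine (mul_le_mul_of_nonneg_left h2 ha.le).trans_eq ?_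
    field_simp
  refine (add_le_add (key hP hu) (key hn hv)).trans_eq ?_
  have : u * (P + n) / (u + v) + v * (P + n) / (u + v) = P + n := by field_simp
  linear_combination this

/-- The shattering inequality obtained from two applications of Warren's theorem bounds the
cardinality of the shattered set. -/
lemma le_mul_logb_of_two_pow_le {N P n t r : ℕ} (hP : 0 < P) (hn : 0 < n) (hN : 0 < N)
    (h : (2 : ℝ) ^ N ≤ (2 * Real.exp 1 * (N * (t + 1 : ℕ) : ℝ) / P) ^ P *
      (2 * Real.exp 1 * N * (r + 1 : ℕ) / n) ^ n) :
    (N : ℝ) ≤ (P + n : ℝ) * Real.logb 2 (4 * Real.exp 1 * ((t : ℝ) + (r : ℝ) + 2) *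
      Real.logb 2 (2 * Real.exp 1 * ((t : ℝ) + (r : ℝ) + 2))) := by
  have hP0 : (0 : ℝ) < P := by exact_mod_cast hP
  have hn0 : (0 : ℝ) < n := by exact_mod_cast hn
  have hN0 : (0 : ℝ) < N := by exact_mod_cast hN
  have he : (2 : ℝ) ≤ Real.exp 1 := by
    have := Real.add_one_le_exp (1 : ℝ)
    linarith
  set b : ℝ := 2 * Real.exp 1 * ((t : ℝ) + (r : ℝ) + 2) with hb
  have hb4 : 4 ≤ b := by
    have h1 : (0 : ℝ) ≤ t := Nat.cast_nonneg _
    have h2 : (0 : ℝ) ≤ r := Nat.cast_nonneg _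
    nlinarith
  rw [show 4 * Real.exp 1 * ((t : ℝ) + (r : ℝ) + 2) = 2 * b by rw [hb]; ring]
  by_contra! hlt
  have h1 := log_mul_lt_mul_log_two hb4 ((lt_div_iff₀' (by positivity)).2 hlt)
  have h2 := Real.log_le_log (by positivity) h
  rw [Real.log_mul (by positivity) (by positivity), Real.log_pow, Real.log_pow, Real.log_pow,
    ← mul_assoc (2 * Real.exp 1)] at h2
  have h3 := h2.trans (mul_log_add_mul_log_le hP0 hn0 (by positivity) (by positivity)
    (by positivity))
  rw [show 2 * Real.exp 1 * N * ((t + 1 : ℕ) + (r + 1 : ℕ) : ℝ) / (P + n) = b * (N / (P + n)) by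
    rw [hb]; push_cast; ring] at h3
  have h4 := mul_lt_mul_of_pos_left h1 (by positivity : (0 : ℝ) < P + n)
  rw [← mul_assoc, mul_div_cancel₀ _ (by positivity)] at h4
  linarith

lemma exists_mem_regularCell {t : ℕ} (ht : 0 < t) {x : ℝ} (hx : x ∈ Set.Icc (0 : ℝ) 1) :
    ∃ h < t, x ∈ regularCell t h := by
  have ht0 : (0 : ℝ) < t := by exact_mod_cast ht
  have h1 : ⌈(t : ℝ) * x⌉₊ ≤ t := Nat.ceil_le.2 (by nlinarith [hx.2])
  rcases Nat.eq_zero_or_pos ⌈(t : ℝ) * x⌉₊ with h | h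
  · refine ⟨0, ht, ?_⟩
    have h2 : x ≤ 0 := by
      have := Nat.ceil_eq_zero.1 h
      by_contra! hpos
      have := mul_pos ht0 hpos
      linarith
    simp only [regularCell, if_true]
    exact ⟨hx.1, h2.trans (by positivity)⟩
  · obtain ⟨k, hk⟩ := Nat.exists_eq_add_of_lt h
    rw [zero_add] at hk
    have h2 : (k : ℝ) < t * x := Nat.lt_ceil.1 (by omega)
    have h3 : t * x ≤ (k : ℝ) + 1 := by
      have := Nat.le_ceil ((t : ℝ) * x)
      rw [hk] at this
      exact_mod_cast this
    refine ⟨k, by omega, ?_⟩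
    by_cases hk0 : k = 0
    · subst hk0
      simp only [regularCell, if_true]
      refine ⟨hx.1, ?_⟩
      rw [le_div_iff₀ ht0]
      simp only [CharP.cast_eq_zero] at h3
      linarith
    · rw [regularCell, if_neg hk0]
      refine ⟨?_, ?_⟩
      · rw [div_lt_iff₀ ht0]
        linarith
      · rw [le_div_iff₀ ht0]
        linarith

lemma dyadicCell_eq_regularCell (s k : ℕ) : dyadicCell s k = regularCell (2 ^ s) k := by
  simp [dyadicCell, regularCell, div_eq_mul_inv]

lemma exists_mem_dyadicCell (s : ℕ) {x : ℝ} (hx : x ∈ Set.Icc (0 : ℝ) 1) :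
    ∃ k < 2 ^ s, x ∈ dyadicCell s k := by
  simpa only [dyadicCell_eq_regularCell] using exists_mem_regularCell (by positivity) hx

lemma clip_mem_regularCell_iff {t h : ℕ} (hh : h < t) (z : ℝ) :
    min (max z 0) 1 ∈ regularCell t h ↔
      (h = 0 ∨ (h : ℝ) / t < z) ∧ (h + 1 = t ∨ ¬ ((h + 1 : ℕ) : ℝ) / t < z) := by
  have ht0 : (0 : ℝ) < t := by exact_mod_cast (Nat.zero_le h).trans_lt hh
  have h1 : (h : ℝ) / t < 1 := by
    rw [div_lt_one ht0]
    exact_mod_cast hh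
  have h2 : (1 : ℝ) ≤ ((h : ℝ) + 1) / t ↔ h + 1 = t := by
    rw [one_le_div ht0]
    exact ⟨fun h3 => le_antisymm hh (by exact_mod_cast h3), fun h3 => by exact_mod_cast h3.ge⟩
  have h4 : (0 : ℝ) ≤ ((h : ℝ) + 1) / t := by positivity
  have h5 : min (max z 0) 1 ≤ ((h : ℝ) + 1) / t ↔ h + 1 = t ∨ ¬ ((h + 1 : ℕ) : ℝ) / t < z := by
    rw [min_le_iff, max_le_iff, h2, not_lt]
    push_cast
    tauto
  rcases Nat.eq_zero_or_pos h with rfl | hpos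
  · simp only [regularCell, if_true, true_or, true_and, Set.mem_Icc]
    rw [← h5]
    simp
  · have h6 : ¬ (h : ℝ) / t < 0 := not_lt.2 (by positivity)
    rw [regularCell, if_neg hpos.ne', Set.mem_Ioc, h5, lt_min_iff, lt_max_iff]
    simp [h1, h6, hpos.ne']

/-- Points on the same side of every threshold `k/t` have their truncations to `[0,1]` in the same
cell. -/
lemma clip_mem_regularCell_of_forall_iff {t h : ℕ} (hh : h < t) {z z' : ℝ}
    (H : ∀ k ≤ t, (k : ℝ) / t < z ↔ (k : ℝ) / t < z') (hz : min (max z 0) 1 ∈ regularCell t h) :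
    min (max z' 0) 1 ∈ regularCell t h := by
  rwa [clip_mem_regularCell_iff hh, ← H _ hh.le, ← H _ hh, ← clip_mem_regularCell_iff hh]

lemma card_le_mul_of_injOn_of_fiber {α β γ : Type*} [DecidableEq β] [DecidableEq γ] (A : Finset α)
    (f : α → β) (g : α → γ) {M N : ℝ}
    (hinj : ∀ x ∈ A, ∀ y ∈ A, f x = f y → g x = g y → x = y)
    (hM : ((A.image f).card : ℝ) ≤ M)
    (hN : ∀ b ∈ A.image f, (((A.filter (f · = b)).image g).card : ℝ) ≤ N) (hN0 : 0 ≤ N) :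
    (A.card : ℝ) ≤ M * N := by
  rw [Finset.card_eq_sum_card_image f A]
  push_cast
  refine (Finset.sum_le_card_nsmul _ _ N fun b hb => ?_).trans ?_
  · rw [← Finset.card_image_of_injOn (f := g)]
    · exact hN b hb
    · intro x hx y hy hxy
      obtain ⟨hx, hxb⟩ := Finset.mem_filter.1 hx
      obtain ⟨hy, hyb⟩ := Finset.mem_filter.1 hy
      exact hinj x hx y hy (hxb.trans hyb.symm) hxy
  · rw [nsmul_eq_mul]
    exact mul_le_mul_of_nonneg_right hM hN0

/-- Parameters of an additive piecewise polynomial `∑ j, g j (w j)`. -/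
abbrev InnerIndex (d : ℕ) (s : Fin d → ℕ) (r : ℕ) : Type :=
  (j : Fin d) × (Fin (2 ^ s j) × Fin (r + 1))

/-- Parameters of a composition of a piecewise polynomial with an additive one. -/
abbrev CompositeIndex (d : ℕ) (s : Fin d → ℕ) (t r : ℕ) : Type :=
  InnerIndex d s r ⊕ (Fin t × Fin (r + 1))

open MvPolynomial in
/-- The value at `w` of an additive piecewise polynomial as a linear form in its coefficients, where
`k j` is the cell of `w j`. -/
noncomputable def innerForm {d : ℕ} {s : Fin d → ℕ} (r : ℕ) (w : Fin d → ℝ)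
    (k : (j : Fin d) → Fin (2 ^ s j)) : MvPolynomial (InnerIndex d s r) ℝ :=
  ∑ j, ∑ i : Fin (r + 1), C (w j ^ (i : ℕ)) * X ⟨j, k j, i⟩

open MvPolynomial in
lemma totalDegree_innerForm_le {d : ℕ} {s : Fin d → ℕ} (r : ℕ) (w : Fin d → ℝ)
    (k : (j : Fin d) → Fin (2 ^ s j)) : (innerForm r w k).totalDegree ≤ 1 :=
  (totalDegree_finsetSum _ _).trans <| Finset.sup_le fun j _ =>
    (totalDegree_finsetSum _ _).trans <| Finset.sup_le fun i _ =>
      (totalDegree_mul _ _).trans (by rw [totalDegree_C, totalDegree_X])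

open MvPolynomial in
/-- The function `w ↦ ∑ j, g j (w j)` and its outer piecewise polynomial are evaluations of
polynomials in the coefficients. -/
lemma exists_coefficients {d : ℕ} {s : Fin d → ℕ} {t r : ℕ} {vm vp : ℝ} {γ : (Fin d → ℝ) → ℝ}
    (hγ : γ ∈ additiveCompositeClass d s t r vm vp) :
    ∃ (θ : InnerIndex d s r → ℝ) (b : Fin t × Fin (r + 1) → ℝ),
      ∀ (w : Fin d → ℝ) (k : (j : Fin d) → Fin (2 ^ s j)),
        (∀ j, w j ∈ dyadicCell (s j) (k j)) → ∀ h : Fin t,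
        min (max (eval θ (innerForm r w k)) 0) 1 ∈ regularCell t h →
        γ w = min (max (∑ i : Fin (r + 1), b (h, i) *
          (min (max (eval θ (innerForm r w k)) 0) 1) ^ (i : ℕ)) vm) vp := by
  obtain ⟨g, hg, ft, hft, rfl⟩ := hγ
  choose c hc using hg
  choose b hb using hft
  refine ⟨fun z => c z.1 z.2.1 z.2.1.2 z.2.2, fun z => b z.1 z.1.2 z.2, fun w k hk h hh => ?_⟩
  have h1 : eval (fun z : InnerIndex d s r => c z.1 z.2.1 z.2.1.2 z.2.2) (innerForm r w k) =
      ∑ j, g j (w j) := by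
    simp only [innerForm, map_sum, map_mul, eval_C, eval_X]
    refine Finset.sum_congr rfl fun j _ => ?_
    rw [hc j (k j) (k j).2 (w j) (hk j)]
    simp only [mul_comm]
  rw [h1] at hh ⊢
  beta_reduce
  rw [hb h h.2 _ hh]

open MvPolynomial in
/-- The number of subsets of a shattered set is bounded by a product of two Warren bounds. -/
lemma two_pow_card_le_of_shattered {d : ℕ} {s : Fin d → ℕ} {t r : ℕ} {vm vp : ℝ} (ht : 0 < t)
    (S : Finset ((Fin d → ℝ) × ℝ)) (hS : ∀ q ∈ S, q.1 ∈ unitCube d)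
    (hsh : ∀ S' ⊆ S, ∃ f ∈ additiveCompositeClass d s t r vm vp,
      (↑S' : Set ((Fin d → ℝ) × ℝ)) = ↑S ∩ {q | q.2 < f q.1})
    (hP : 0 < Fintype.card (InnerIndex d s r))
    (hN : Fintype.card (CompositeIndex d s t r) ≤ S.card) :
    (2 : ℝ) ^ S.card ≤
      (2 * Real.exp 1 * (S.card * (t + 1 : ℕ) : ℝ) / Fintype.card (InnerIndex d s r)) ^
        Fintype.card (InnerIndex d s r) *
      (2 * Real.exp 1 * S.card * (r + 1 : ℕ) / Fintype.card (CompositeIndex d s t r)) ^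
        Fintype.card (CompositeIndex d s t r) := by
  classical
  have ht0 : (t : ℝ) ≠ 0 := by exact_mod_cast ht.ne'
  choose k₀ hk₀ hcell₀ using fun (q : S) j => exists_mem_dyadicCell (s j) (hS q q.2 j)
  let k : (q : S) → (j : Fin d) → Fin (2 ^ s j) := fun q j => ⟨k₀ q j, hk₀ q j⟩
  have hcell : ∀ q j, q.1.1 j ∈ dyadicCell (s j) (k q j) := hcell₀
  choose! f hf hfS using hsh
  choose! θ b hγ using fun S' hS' => exists_coefficients (hf S' hS')
  let L : S → MvPolynomial (InnerIndex d s r) ℝ := fun q => innerForm r q.1.1 (k q)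
  let z : Finset ((Fin d → ℝ) × ℝ) → S → ℝ := fun S' q => eval (θ S') (L q)
  let p₁ : S × Fin (t + 1) → MvPolynomial (InnerIndex d s r) ℝ := fun u =>
    L u.1 - C ((u.2 : ℝ) / t)
  let pat₁ : Finset ((Fin d → ℝ) × ℝ) → Set (S × Fin (t + 1)) := fun S' =>
    {u | 0 < eval (θ S') (p₁ u)}
  have hpat₁ : ∀ S' q (m : Fin (t + 1)), (q, m) ∈ pat₁ S' ↔ (m : ℝ) / t < z S' q := by
    intro S' q m
    simp [pat₁, p₁, z]
  have hcl : ∀ S' q, ∃ h : Fin t, min (max (z S' q) 0) 1 ∈ regularCell t h := fun S' q => by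
    obtain ⟨h, hh, hm⟩ := exists_mem_regularCell ht (x := min (max (z S' q) 0) 1)
      ⟨le_min (le_max_right _ _) zero_le_one, min_le_right _ _⟩
    exact ⟨⟨h, hh⟩, hm⟩
  obtain ⟨cl, hcl⟩ : ∃ cl : Set (S × Fin (t + 1)) → S → Fin t, ∀ S' q,
      min (max (z S' q) 0) 1 ∈ regularCell t (cl (pat₁ S') q) := by
    choose h hh using hcl
    refine ⟨fun a q => h (Function.invFun pat₁ a) q, fun S' q => ?_⟩
    have hinv : pat₁ (Function.invFun pat₁ (pat₁ S')) = pat₁ S' :=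
      Function.invFun_eq ⟨S', rfl⟩
    refine clip_mem_regularCell_of_forall_iff (Fin.is_lt _) (fun m hm => ?_) (hh _ q)
    have h1 := hpat₁ (Function.invFun pat₁ (pat₁ S')) q ⟨m, by omega⟩
    rw [hinv] at h1
    exact h1.symm.trans (hpat₁ S' q ⟨m, by omega⟩)
  let x : Set (S × Fin (t + 1)) → S → MvPolynomial (InnerIndex d s r) ℝ := fun a q =>
    if (q, Fin.last t) ∈ a then 1 else if (q, 0) ∈ a then L q else 0
  have hxdeg : ∀ a q, (x a q).totalDegree ≤ 1 := by
    intro a q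
    simp only [x]
    split_ifs
    · simp
    · exact totalDegree_innerForm_le _ _ _
    · simp
  have hx : ∀ S' q, eval (θ S') (x (pat₁ S') q) = min (max (z S' q) 0) 1 := by
    intro S' q
    simp only [x, hpat₁, Fin.val_last, div_self ht0, Fin.val_zero, Nat.cast_zero, zero_div]
    split_ifs with h1 h2
    · rw [max_eq_left (by linarith), min_eq_right h1.le, map_one]
    · rw [max_eq_left h2.le, min_eq_left (not_lt.1 h1)]
    · rw [max_eq_right (not_lt.1 h2), min_eq_left zero_le_one, map_zero]
  let p₂ : Set (S × Fin (t + 1)) → S → MvPolynomial (CompositeIndex d s t r) ℝ := fun a q =>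
    ∑ i : Fin (r + 1), X (.inr (cl a q, i)) * rename .inl (x a q) ^ (i : ℕ) - C q.1.2
  have hp₂ : ∀ a q, (p₂ a q).totalDegree ≤ r + 1 := by
    intro a q
    refine (totalDegree_sub_C_le _ _).trans ((totalDegree_finsetSum _ _).trans
      (Finset.sup_le fun i _ => (totalDegree_mul _ _).trans ?_))
    have h1 : (rename (Sum.inl : _ → CompositeIndex d s t r) (x a q) ^ (i : ℕ)).totalDegree ≤ i :=
      (totalDegree_pow _ _).trans (by
        simpa using Nat.mul_le_mul_left (i : ℕ)
          ((totalDegree_rename_le _ _).trans (hxdeg a q)))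
    have := i.2
    rw [totalDegree_X]
    omega
  let pat₂ : Finset ((Fin d → ℝ) × ℝ) → Set S := fun S' =>
    {q | 0 < eval (Sum.elim (θ S') (b S')) (p₂ (pat₁ S') q)}
  have hpat₂ : ∀ S' ⊆ S, ∀ q : S, q.1 ∈ S' ↔ q.1.2 < vp ∧ (q ∈ pat₂ S' ∨ q.1.2 < vm) := by
    intro S' hS' q
    have h1 : q.1 ∈ S' ↔ q.1.2 < f S' q.1.1 := by
      rw [← Finset.mem_coe, hfS S' hS']
      simp
    have h2 : q ∈ pat₂ S' ↔ q.1.2 < ∑ i : Fin (r + 1), b S' (cl (pat₁ S') q, i) *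
        (min (max (z S' q) 0) 1) ^ (i : ℕ) := by
      simp [pat₂, p₂, eval_rename, hx]
    rw [h1, h2, hγ S' hS' q.1.1 (k q) (hcell q) _ (hcl S' q), lt_min_iff, lt_max_iff, and_comm]
  have hcard : (2 : ℝ) ^ S.card = S.powerset.card := by simp
  rw [hcard]
  refine card_le_mul_of_injOn_of_fiber S.powerset pat₁ pat₂ ?_ ?_ ?_ (by positivity)
  · intro S₁ h₁ S₂ h₂ _ h
    rw [Finset.mem_powerset] at h₁ h₂
    ext q
    by_cases hq : q ∈ S
    · exact (hpat₂ S₁ h₁ ⟨q, hq⟩).trans (h ▸ (hpat₂ S₂ h₂ ⟨q, hq⟩).symm)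
    · exact ⟨fun h => absurd (h₁ h) hq, fun h => absurd (h₂ h) hq⟩
  · have hc : Fintype.card (InnerIndex d s r) ≤ Fintype.card (S × Fin (t + 1)) := by
      rw [Fintype.card_sum] at hN
      simp only [Fintype.card_prod, Fintype.card_coe, Fintype.card_fin]
      nlinarith
    have := card_sign_patterns_le_exp_pow p₁ le_rfl
      (fun u => (totalDegree_sub_C_le _ _).trans (totalDegree_innerForm_le _ _ _)) hP hc
      (S.powerset.image pat₁) fun a ha => by
        obtain ⟨S', _, rfl⟩ := Finset.mem_image.1 ha
        exact ⟨θ S', rfl⟩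
    simpa only [Fintype.card_prod, Fintype.card_coe, Fintype.card_fin, Nat.cast_mul, Nat.cast_one,
      mul_one] using this
  · intro a _
    have := card_sign_patterns_le_exp_pow (p₂ a) (Nat.le_add_left 1 r) (hp₂ a)
      (by rw [Fintype.card_sum]; omega) (by simpa only [Fintype.card_coe] using hN)
      ((S.powerset.filter (pat₁ · = a)).image pat₂) fun c hc => by
        obtain ⟨S', hS', rfl⟩ := Finset.mem_image.1 hc
        obtain ⟨_, rfl⟩ := Finset.mem_filter.1 hS'
        exact ⟨_, rfl⟩
    simpa only [Fintype.card_coe] using this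

lemma card_innerIndex (d : ℕ) (s : Fin d → ℕ) (r : ℕ) :
    Fintype.card (InnerIndex d s r) = (∑ j, 2 ^ s j) * (r + 1) := by
  simp [Fintype.card_sigma, Finset.sum_mul]

/-- **VC dimension of generalized additive composite classes (Proposition 1, Section 5).**
With `|π_j| = 2^{s_j}` and `U = t + r + 2`, the class `Γ̄^A_{(π,t,r)}` is VC-subgraph on
`[0,1]^d` with dimension at most
`2 + [t(r+1) + 2 ∑_j |π_j| (r+1)] log₂(4eU log₂(2eU))`. -/
theorem additive_composite_class_vc_dimension
    (d : ℕ) (hd : 0 < d) (r t : ℕ) (ht : 0 < t) (s : Fin d → ℕ)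
    (vm vp : ℝ) (hv : vm < vp) :
    VCSubgraphLEOn (unitCube d) (additiveCompositeClass d s t r vm vp)
      (2 + ((t : ℝ) * ((r : ℝ) + 1) + 2 * (∑ j, (2:ℝ) ^ (s j)) * ((r : ℝ) + 1)) *
        Real.logb 2 (4 * Real.exp 1 * ((t : ℝ) + (r : ℝ) + 2) *
          Real.logb 2 (2 * Real.exp 1 * ((t : ℝ) + (r : ℝ) + 2)))) := by

  intro S hS hcard
  by_contra! hsh
  set P := Fintype.card (InnerIndex d s r) with hPdef
  set n := Fintype.card (CompositeIndex d s t r) with hndef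
  have hP : P = (∑ j, 2 ^ s j) * (r + 1) := card_innerIndex d s r
  have hn : n = P + t * (r + 1) := by
    rw [hndef, Fintype.card_sum, Fintype.card_prod, Fintype.card_fin, Fintype.card_fin]
  have hP0 : 0 < P := by
    have : Nonempty (Fin d) := ⟨⟨0, hd⟩⟩
    rw [hP]
    exact Nat.mul_pos (Finset.sum_pos (fun j _ => by positivity) Finset.univ_nonempty)
      (Nat.succ_pos r)
  have hW : (t : ℝ) * ((r : ℝ) + 1) + 2 * (∑ j, (2 : ℝ) ^ (s j)) * ((r : ℝ) + 1) = P + n := by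
    rw [hn, hP]
    push_cast
    ring
  rw [hW] at hcard
  have he := Real.add_one_le_exp (1 : ℝ)
  have hlog := (two_le_logb_two_mul_logb (b := 2 * Real.exp 1 * ((t : ℝ) + r + 2)) (by
    have h1 : (0 : ℝ) ≤ t := Nat.cast_nonneg _
    have h2 : (0 : ℝ) ≤ r := Nat.cast_nonneg _
    nlinarith)).2
  rw [show 2 * (2 * Real.exp 1 * ((t : ℝ) + r + 2)) = 4 * Real.exp 1 * ((t : ℝ) + r + 2) by ring]
    at hlog
  have hnS : n ≤ S.card := by
    have h1 : (0 : ℝ) ≤ P := Nat.cast_nonneg _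
    have h2 : (0 : ℝ) ≤ n := Nat.cast_nonneg _
    have h3 : (n : ℝ) ≤ S.card := by nlinarith
    exact_mod_cast h3
  have hbound := le_mul_logb_of_two_pow_le hP0 (by omega) (by omega)
    (two_pow_card_le_of_shattered ht S hS hsh hP0 hnS)
  linarith
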